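/- Assume (F), (W) and (P2). Suppose ρ_R≤ρ̄<ρ_L, p(ρ_L−)≠p(ρ_L+) and p(ρ_L+)≤f(ρ_L)≤p(ρ_L−) (case (NNN4)). Then for each p̄∈{p(ρ_L+), f(ρ_L), p(ρ_L−)} there exist T>0 and an entropy weak solution ρ on [0,T) of the constrained Riemann problem with non-local constraint such that f(ρ(t,0−))=f(ρ(t,0+))=p̄ for a.e. t∈(0,T); in particular there exist at least two entropy weak solutions that do not coincide a.e. on (0,τ)×ℝ for any small τ>0. -/

import Mathlib

open MeasureTheory Set Filter

namespace CRP

noncomputable section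

/-- Smooth compactly supported test functions on `ℝ²`. -/
def TestFn (φ : ℝ × ℝ → ℝ) : Prop :=
  ContDiff ℝ (⊤ : ℕ∞) φ ∧ HasCompactSupport φ

/-- Partial derivative of a test function in the first (time) variable. -/
def pdT (φ : ℝ × ℝ → ℝ) (z : ℝ × ℝ) : ℝ := fderiv ℝ φ z (1, 0)

/-- Partial derivative of a test function in the second (space) variable. -/
def pdX (φ : ℝ × ℝ → ℝ) (z : ℝ × ℝ) : ℝ := fderiv ℝ φ z (0, 1)

/-- Assumption (F): `f : [0,R] → [0,∞)` is Lipschitz, `f 0 = 0 = f R`, and there is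
`ρb ∈ (0,R)` with `f' ρ * (ρb - ρ) > 0` for a.e. `ρ ∈ [0,R]`. -/
def AF (R ρb : ℝ) (f : ℝ → ℝ) : Prop :=
  0 < R ∧ (∃ L : NNReal, LipschitzOnWith L f (Icc 0 R)) ∧
    (∀ x ∈ Icc (0:ℝ) R, 0 ≤ f x) ∧ f 0 = 0 ∧ f R = 0 ∧ ρb ∈ Ioo 0 R ∧
    (∀ᵐ x ∂(volume.restrict (Icc (0:ℝ) R)), deriv f x * (ρb - x) > 0)

/-- Assumption (W): `w` is a nonnegative non-decreasing weight on `ℝ₋` with unit integral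
and support in `[-i_w, 0]`. -/
def AW (w : ℝ → ℝ) : Prop :=
  (∀ x ≤ (0:ℝ), 0 ≤ w x) ∧ MonotoneOn w (Iic 0) ∧
    (∫ x in Iic (0:ℝ), w x) = 1 ∧ ∃ iw : ℝ, 0 < iw ∧ ∀ x ≤ -iw, w x = 0

/-- Assumption (P2): `p : [0,R] → (0, fmax]` is non-increasing and piecewise constant
with finitely many jumps (equivalently, it has finitely many values). -/
def AP2 (R fmax : ℝ) (p : ℝ → ℝ) : Prop :=
  AntitoneOn p (Icc 0 R) ∧ (∀ ξ ∈ Icc (0:ℝ) R, p ξ ∈ Ioc 0 fmax) ∧ (p '' Icc 0 R).Finite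

/-- The left limit `p(ξ−)` of a non-increasing piecewise constant `p` on `[0,R]`,
with the convention `p(0−) = p 0`. -/
def pminus (p : ℝ → ℝ) (ξ : ℝ) : ℝ := if ξ ≤ 0 then p 0 else sInf (p '' Ico 0 ξ)

/-- The right limit `p(ξ+)` of a non-increasing piecewise constant `p` on `[0,R]`,
with the convention `p(R+) = p R`. -/
def pplus (R : ℝ) (p : ℝ → ℝ) (ξ : ℝ) : ℝ := if R ≤ ξ then p R else sSup (p '' Ioc ξ R)

/-- `γ` is the left measure-theoretic trace of `ρ` at `x = 0`. -/
def LeftTraceAt (ρ : ℝ → ℝ → ℝ) (γ : ℝ → ℝ) : Prop :=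
  ∀ φ : ℝ × ℝ → ℝ, TestFn φ →
    Tendsto (fun ε : ℝ => (1 / ε) * ∫ t in Ioi (0:ℝ), ∫ x in Ioo (-ε) (0:ℝ),
        |ρ t x - γ t| * φ (t, x)) (nhdsWithin 0 (Ioi 0)) (nhds 0)

/-- `γ` is the right measure-theoretic trace of `ρ` at `x = 0`. -/
def RightTraceAt (ρ : ℝ → ℝ → ℝ) (γ : ℝ → ℝ) : Prop :=
  ∀ φ : ℝ × ℝ → ℝ, TestFn φ →
    Tendsto (fun ε : ℝ => (1 / ε) * ∫ t in Ioi (0:ℝ), ∫ x in Ioo (0:ℝ) ε,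
        |ρ t x - γ t| * φ (t, x)) (nhdsWithin 0 (Ioi 0)) (nhds 0)

/-- The constrained entropy inequality (i), with constraint level `q`, initial datum `ρ0`,
tested on all nonnegative test functions. -/
def EntIneq (R fmax : ℝ) (f q ρ0 : ℝ → ℝ) (ρ : ℝ → ℝ → ℝ) : Prop :=
  ∀ φ : ℝ × ℝ → ℝ, TestFn φ → (∀ z, 0 ≤ φ z) → ∀ k ∈ Icc (0:ℝ) R,
    0 ≤ (∫ t in Ioi (0:ℝ), ∫ x : ℝ,
          (|ρ t x - k| * pdT φ (t, x) +
            Real.sign (ρ t x - k) * (f (ρ t x) - f k) * pdX φ (t, x))) +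
        2 * (∫ t in Ioi (0:ℝ), (1 - q t / fmax) * f k * φ (t, 0)) +
        ∫ x : ℝ, |ρ0 x - k| * φ (0, x)

/-- The constrained entropy inequality (i) on the time interval `[0,T)`: only test
functions supported in `(-∞,T) × ℝ` are used. -/
def EntIneqOn (R fmax T : ℝ) (f q ρ0 : ℝ → ℝ) (ρ : ℝ → ℝ → ℝ) : Prop :=
  ∀ φ : ℝ × ℝ → ℝ, TestFn φ → (∀ z, 0 ≤ φ z) →
    tsupport φ ⊆ Iio T ×ˢ (univ : Set ℝ) → ∀ k ∈ Icc (0:ℝ) R,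
    0 ≤ (∫ t in Ioi (0:ℝ), ∫ x : ℝ,
          (|ρ t x - k| * pdT φ (t, x) +
            Real.sign (ρ t x - k) * (f (ρ t x) - f k) * pdX φ (t, x))) +
        2 * (∫ t in Ioi (0:ℝ), (1 - q t / fmax) * f k * φ (t, 0)) +
        ∫ x : ℝ, |ρ0 x - k| * φ (0, x)

/-- Basic regularity required of solutions: measurability, values in `[0,R]`, and
continuity in time with values in `L¹loc` (on compact sets `[-r,r]`). -/
def RegSol (R : ℝ) (ρ : ℝ → ℝ → ℝ) : Prop :=
  Measurable (Function.uncurry ρ) ∧ (∀ t x, ρ t x ∈ Icc (0:ℝ) R) ∧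
    ∀ r : ℝ, 0 < r → ∀ s : ℝ, 0 ≤ s →
      Tendsto (fun t => ∫ x in Icc (-r) r, |ρ t x - ρ s x|) (nhdsWithin s (Ici 0)) (nhds 0)

/-- `ρ`, with traces `γm`, `γp` at `x = 0`, satisfies the constrained entropy
inequalities with constraint level `q : (0,∞) → [0,fmax]` and initial datum `ρ0`. -/
def CEI (R fmax : ℝ) (f q ρ0 : ℝ → ℝ) (ρ : ℝ → ℝ → ℝ) (γm γp : ℝ → ℝ) : Prop :=
  RegSol R ρ ∧ (∀ t, q t ∈ Icc (0:ℝ) fmax) ∧ EntIneq R fmax f q ρ0 ρ ∧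
    LeftTraceAt ρ γm ∧ RightTraceAt ρ γp ∧
    (∀ᵐ t ∂(volume.restrict (Ioi (0:ℝ))), f (γm t) ≤ q t ∧ f (γp t) ≤ q t)

/-- Same as `CEI`, but on the time interval `[0,T)`. -/
def CEIOn (R fmax T : ℝ) (f q ρ0 : ℝ → ℝ) (ρ : ℝ → ℝ → ℝ) (γm γp : ℝ → ℝ) : Prop :=
  RegSol R ρ ∧ (∀ t, q t ∈ Icc (0:ℝ) fmax) ∧ EntIneqOn R fmax T f q ρ0 ρ ∧
    LeftTraceAt ρ γm ∧ RightTraceAt ρ γp ∧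
    (∀ᵐ t ∂(volume.restrict (Ioo (0:ℝ) T)), f (γm t) ≤ q t ∧ f (γp t) ≤ q t)

/-- The weighted average `ξ(t) = ∫_{ℝ₋} w x * ρ t x dx`. -/
def wAvg (w : ℝ → ℝ) (ρ : ℝ → ℝ → ℝ) (t : ℝ) : ℝ := ∫ x in Iic (0:ℝ), w x * ρ t x

/-- Entropy weak solution of the Cauchy problem with non-local point constraint given by
the (possibly multivalued, filled-in) piecewise constant `p`: there is a constraint level
`q` with `q t ∈ P(ξ(t)) = [p(ξ(t)+), p(ξ(t)−)]` a.e. such that `ρ` satisfies the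
constrained entropy inequalities with constraint level `q`. -/
def EWSol (R fmax : ℝ) (f w p ρ0 : ℝ → ℝ) (ρ : ℝ → ℝ → ℝ) (γm γp : ℝ → ℝ) : Prop :=
  ∃ q : ℝ → ℝ, CEI R fmax f q ρ0 ρ γm γp ∧
    ∀ᵐ t ∂(volume.restrict (Ioi (0:ℝ))),
      q t ∈ Icc (pplus R p (wAvg w ρ t)) (pminus p (wAvg w ρ t))

/-- Entropy weak solution with non-local constraint on the time interval `[0,T)`. -/
def EWSolOn (R fmax T : ℝ) (f w p ρ0 : ℝ → ℝ) (ρ : ℝ → ℝ → ℝ) (γm γp : ℝ → ℝ) : Prop :=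
  ∃ q : ℝ → ℝ, CEIOn R fmax T f q ρ0 ρ γm γp ∧
    ∀ᵐ t ∂(volume.restrict (Ioo (0:ℝ) T)),
      q t ∈ Icc (pplus R p (wAvg w ρ t)) (pminus p (wAvg w ρ t))

/-- The Riemann initial datum. -/
def riem (ρL ρR : ℝ) (x : ℝ) : ℝ := if x < 0 then ρL else ρR

/-- `ρ1 = ρ2` a.e. on `(0,T) × ℝ`. -/
def aeEqOn (T : ℝ) (ρ1 ρ2 : ℝ → ℝ → ℝ) : Prop :=
  ∀ᵐ z ∂((volume : Measure (ℝ × ℝ)).restrict (Ioo (0:ℝ) T ×ˢ (univ : Set ℝ))),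
    ρ1 z.1 z.2 = ρ2 z.1 z.2

section

/-- The self-similar entropy flux `Φ(v) - ξ η(v)`. -/
def hK (g v : ℝ → ℝ) (k ξ : ℝ) : ℝ :=
  Real.sign (v ξ - k) * (g (v ξ) - g k) - ξ * |v ξ - k|

/-- The entropy inequality of a self-similar profile on every interval. -/
def FanIneq (g v : ℝ → ℝ) : Prop :=
  ∀ k α β : ℝ, α ≤ β → ∀ χ χ' : ℝ → ℝ, (∀ x, HasDerivAt χ (χ' x) x) → Continuous χ' →
    (∀ x, 0 ≤ χ x) →
    hK g v k β * χ β - hK g v k α * χ α ≤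
      ∫ ξ in α..β, (hK g v k ξ * χ' ξ - |v ξ - k| * χ ξ)

theorem argmin_mono (g : ℝ → ℝ) (a b : ℝ) (v : ℝ → ℝ)
    (hv : ∀ ξ, v ξ ∈ Icc a b)
    (hmin : ∀ ξ, ∀ ρ ∈ Icc a b, g (v ξ) - ξ * v ξ ≤ g ρ - ξ * ρ) : Monotone v := by
  intro ξ ξ' h
  rcases h.eq_or_lt with rfl | h
  · exact le_rfl
  have h1 := hmin ξ _ (hv ξ')
  have h2 := hmin ξ' _ (hv ξ)
  by_contra hc
  push Not at hc
  nlinarith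

theorem fan_of_argmin (g : ℝ → ℝ) (a b : ℝ) (v : ℝ → ℝ)
    (hv : ∀ ξ, v ξ ∈ Icc a b)
    (hmin : ∀ ξ, ∀ ρ ∈ Icc a b, g (v ξ) - ξ * v ξ ≤ g ρ - ξ * ρ) : FanIneq g v := by
  have hmono := argmin_mono g a b v hv hmin
  intro k α β hαβ χ χ' hχ hχ' hpos
  set n : ℝ → ℝ := fun ξ => g (v ξ) - ξ * v ξ - (g k - ξ * k) with hn
  have hχc : Continuous χ := continuous_iff_continuousAt.2 fun x => (hχ x).continuousAt
  have key1 : ∀ ξ ξ', n ξ' - n ξ ≤ -(ξ' - ξ) * (v ξ - k) := by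
    intro ξ ξ'
    have := hmin ξ' _ (hv ξ)
    simp only [hn]; nlinarith
  have habs : ∀ ξ ξ', |n ξ' - n ξ - (ξ' - ξ) * (-(v ξ - k))| ≤ |ξ' - ξ| * |v ξ' - v ξ| := by
    intro ξ ξ'
    have h1 := key1 ξ ξ'
    have h2 := key1 ξ' ξ
    rw [← abs_mul]
    refine abs_le.2 ⟨?_, ?_⟩
    · have := le_abs_self ((ξ' - ξ) * (v ξ' - v ξ))
      nlinarith
    · have := abs_nonneg ((ξ' - ξ) * (v ξ' - v ξ))
      nlinarith
  have hder : ∀ ξ, ContinuousAt v ξ → HasDerivAt n (-(v ξ - k)) ξ := by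
    intro ξ hξ
    rw [hasDerivAt_iff_isLittleO, Asymptotics.isLittleO_iff]
    intro c hc
    have := Metric.continuousAt_iff'.1 hξ c hc
    filter_upwards [this] with ξ' h'
    rw [Real.dist_eq] at h'
    simp only [smul_eq_mul, Real.norm_eq_abs]
    have := habs ξ ξ'
    have h0 := abs_nonneg (ξ' - ξ)
    nlinarith
  have hncont : Continuous n := by
    rw [continuous_iff_continuousAt]
    intro ξ
    have hb : ∀ ξ', |n ξ' - n ξ| ≤ (|b - a| + |v ξ - k|) * |ξ' - ξ| := by
      intro ξ'
      have h1 := habs ξ ξ'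
      have h2 : |v ξ' - v ξ| ≤ |b - a| := by
        have := hv ξ; have := hv ξ'
        simp only [mem_Icc] at *
        rw [abs_of_nonneg (by linarith : 0 ≤ b - a)]
        exact abs_le.2 ⟨by linarith, by linarith⟩
      have h3 : |n ξ' - n ξ| ≤ |n ξ' - n ξ - (ξ' - ξ) * (-(v ξ - k))| + |(ξ' - ξ) * (-(v ξ - k))| := by
        have := abs_add_le (n ξ' - n ξ - (ξ' - ξ) * (-(v ξ - k))) ((ξ' - ξ) * (-(v ξ - k)))
        simpa using this
      rw [abs_mul, abs_neg] at h3
      have h0 := abs_nonneg (ξ' - ξ)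
      nlinarith
    rw [ContinuousAt, tendsto_iff_dist_tendsto_zero]
    refine squeeze_zero (g := fun ξ' => (|b - a| + |v ξ - k|) * |ξ' - ξ|)
      (fun _ => dist_nonneg) (fun ξ' => hb ξ') ?_
    have : Continuous fun ξ' : ℝ => (|b - a| + |v ξ - k|) * |ξ' - ξ| := by fun_prop
    simpa using this.tendsto ξ
  have hIntv : ∀ α' β' : ℝ, IntervalIntegrable (fun ξ => n ξ * χ' ξ - (v ξ - k) * χ ξ) volume α' β' := by
    intro α' β'
    refine ((hncont.mul hχ').intervalIntegrable _ _).sub ?_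
    exact ((hmono.intervalIntegrable).sub (intervalIntegrable_const)).mul_continuousOn hχc.continuousOn
  have hpiece : ∀ α' β' : ℝ, ∫ ξ in α'..β', (n ξ * χ' ξ - (v ξ - k) * χ ξ) = n β' * χ β' - n α' * χ α' := by
    intro α' β'
    refine integral_eq_of_hasDerivAt_off_countable (fun ξ => n ξ * χ ξ) _
      hmono.countable_not_continuousAt (hncont.mul hχc).continuousOn ?_ (hIntv _ _)
    intro x hx
    have hx' : ContinuousAt v x := by
      by_contra h; exact hx.2 h
    have := (hder x hx').mul (hχ x)
    refine this.congr_deriv ?_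
    ring
  have hhi : ∀ ξ, k ≤ v ξ → hK g v k ξ = n ξ ∧ |v ξ - k| = v ξ - k := by
    intro ξ h
    refine ⟨?_, abs_of_nonneg (by linarith)⟩
    rcases h.eq_or_lt with h | h
    · simp [hK, hn, ← h]
    · have : 0 < v ξ - k := by linarith
      simp only [hK, hn, Real.sign_of_pos this, abs_of_pos this]; ring
  have hlo : ∀ ξ, v ξ ≤ k → hK g v k ξ = - n ξ ∧ |v ξ - k| = -(v ξ - k) := by
    intro ξ h
    refine ⟨?_, abs_of_nonpos (by linarith)⟩
    rcases h.eq_or_lt with h | h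
    · simp [hK, hn, h]
    · have : v ξ - k < 0 := by linarith
      simp only [hK, hn, Real.sign_of_neg this, abs_of_neg this]; ring
  by_cases hA : k ≤ v α
  · have : ∀ ξ ∈ Icc α β, k ≤ v ξ := fun ξ hξ => hA.trans (hmono hξ.1)
    rw [(hhi α hA).1, (hhi β (this β ⟨hαβ, le_rfl⟩)).1]
    rw [← hpiece α β]
    apply le_of_eq
    apply intervalIntegral.integral_congr
    intro ξ hξ
    rw [uIcc_of_le hαβ] at hξ
    simp only [(hhi ξ (this ξ hξ)).1, (hhi ξ (this ξ hξ)).2]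
  by_cases hB : v β ≤ k
  · have : ∀ ξ ∈ Icc α β, v ξ ≤ k := fun ξ hξ => (hmono hξ.2).trans hB
    rw [(hlo α (by linarith)).1, (hlo β hB).1]
    have h2 := hpiece α β
    have : ∫ ξ in α..β, (hK g v k ξ * χ' ξ - |v ξ - k| * χ ξ) =
        ∫ ξ in α..β, -(n ξ * χ' ξ - (v ξ - k) * χ ξ) := by
      apply intervalIntegral.integral_congr
      intro ξ hξ
      rw [uIcc_of_le hαβ] at hξ
      simp only [(hlo ξ (this ξ hξ)).1, (hlo ξ (this ξ hξ)).2]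
      ring
    rw [this, intervalIntegral.integral_neg, h2]
    linarith
  push Not at hA hB
  set S : Set ℝ := {ξ | ξ ∈ Icc α β ∧ v ξ ≤ k} with hS
  have hαS : α ∈ S := ⟨⟨le_rfl, hαβ⟩, hA.le⟩
  have hbdd : BddAbove S := ⟨β, fun x hx => hx.1.2⟩
  set c := sSup S with hc
  have hαc : α ≤ c := le_csSup hbdd hαS
  have hcβ : c ≤ β := csSup_le ⟨α, hαS⟩ fun x hx => hx.1.2
  have hl : ∀ ξ, ξ < c → v ξ ≤ k := by
    intro ξ hξ
    obtain ⟨s, hs, hs'⟩ := exists_lt_of_lt_csSup ⟨α, hαS⟩ hξ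
    exact (hmono hs'.le).trans hs.2
  have hr : ∀ ξ, c < ξ → ξ ≤ β → k ≤ v ξ := by
    intro ξ hξ h'
    by_contra hcon
    push Not at hcon
    exact absurd (le_csSup hbdd (⟨⟨hαc.trans hξ.le, h'⟩, hcon.le⟩ : ξ ∈ S)) (not_le.2 hξ)
  have e1 : ∫ ξ in α..c, (hK g v k ξ * χ' ξ - |v ξ - k| * χ ξ) = -(n c * χ c - n α * χ α) := by
    rw [← hpiece, ← intervalIntegral.integral_neg]
    apply intervalIntegral.integral_congr_ae
    have : ∀ᵐ x : ℝ, x ≠ c := by simp [ae_iff]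
    filter_upwards [this] with x hx hxI
    rw [uIoc_of_le hαc] at hxI
    have h := hlo x (hl x (lt_of_le_of_ne hxI.2 hx))
    simp only [h.1, h.2]; ring
  have e2 : ∫ ξ in c..β, (hK g v k ξ * χ' ξ - |v ξ - k| * χ ξ) = (n β * χ β - n c * χ c) := by
    rw [← hpiece]
    apply intervalIntegral.integral_congr_ae
    refine Eventually.of_forall fun x hxI => ?_
    rw [uIoc_of_le hcβ] at hxI
    have h := hhi x (hr x hxI.1 hxI.2)
    simp only [h.1, h.2]
  have i1 : IntervalIntegrable (fun ξ => hK g v k ξ * χ' ξ - |v ξ - k| * χ ξ) volume α c := by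
    refine (hIntv α c).neg.congr_ae ?_
    rw [uIoc_of_le hαc]
    have : ∀ᵐ x : ℝ, x ≠ c := by simp [ae_iff]
    filter_upwards [ae_restrict_of_ae this, ae_restrict_mem measurableSet_Ioc] with x hx hxI
    have h := hlo x (hl x (lt_of_le_of_ne hxI.2 hx))
    simp only [h.1, h.2, Pi.neg_apply]; ring
  have i2 : IntervalIntegrable (fun ξ => hK g v k ξ * χ' ξ - |v ξ - k| * χ ξ) volume c β := by
    refine (hIntv c β).congr_ae ?_
    rw [uIoc_of_le hcβ]
    filter_upwards [ae_restrict_mem measurableSet_Ioc] with x hxI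
    have h := hhi x (hr x hxI.1 hxI.2)
    simp only [h.1, h.2]
  rw [← intervalIntegral.integral_add_adjacent_intervals i1 i2, e1, e2, (hlo α hA.le).1, (hhi β hB.le).1]
  have hk : k ∈ Icc a b := ⟨(hv α).1.trans hA.le, hB.le.trans (hv β).2⟩
  have hnc : n c ≤ 0 := by
    have := hmin c k hk
    simp only [hn]; linarith
  have := mul_nonneg (neg_nonneg.2 hnc) (hpos c)
  linarith

theorem FanIneq.neg {g v : ℝ → ℝ} (h : FanIneq (fun x => - g (-x)) (fun ξ => - v ξ)) :
    FanIneq g v := by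
  have e : ∀ k ξ, hK (fun x => - g (-x)) (fun ξ => - v ξ) (-k) ξ = hK g v k ξ := by
    intro k ξ
    simp only [hK, neg_neg]
    have : - v ξ - -k = -(v ξ - k) := by ring
    rw [this, abs_neg, Real.sign_neg]; ring
  intro k α β hαβ χ χ' h1 h2 h3
  have := h (-k) α β hαβ χ χ' h1 h2 h3
  simp only [e] at this
  have e2 : ∀ ξ, |-v ξ - -k| = |v ξ - k| := fun ξ => by
    rw [show - v ξ - -k = -(v ξ - k) by ring, abs_neg]
  simpa only [e2] using this

/-- The data of a fan joining `a` to `b`. -/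
structure IsFan (g : ℝ → ℝ) (L a b : ℝ) (v : ℝ → ℝ) : Prop where
  meas : Measurable v
  cnt : {ξ | ¬ ContinuousAt v ξ}.Countable
  ineq : FanIneq g v
  mem : ∀ ξ, v ξ ∈ uIcc a b
  left : ∀ ξ, ξ < -L → v ξ = a
  right : ∀ ξ, L < ξ → v ξ = b
  var1 : a ≤ b → ∀ ξ, ∀ ρ ∈ Icc a b, g (v ξ) - ξ * v ξ ≤ g ρ - ξ * ρ
  var2 : b ≤ a → ∀ ξ, ∀ ρ ∈ Icc b a, g ρ - ξ * ρ ≤ g (v ξ) - ξ * v ξ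

theorem exists_argmin (g : ℝ → ℝ) (hg : Continuous g) (L a b : ℝ)
    (hL : ∀ x y, |g x - g y| ≤ L * |x - y|) (hab : a ≤ b) :
    ∃ v : ℝ → ℝ, (∀ ξ, v ξ ∈ Icc a b) ∧
    (∀ ξ, ∀ ρ ∈ Icc a b, g (v ξ) - ξ * v ξ ≤ g ρ - ξ * ρ) ∧
    (∀ ξ, ξ < -L → v ξ = a) ∧ (∀ ξ, L < ξ → v ξ = b) := by
  have : ∀ ξ : ℝ, ∃ x ∈ Icc a b, ∀ ρ ∈ Icc a b, g x - ξ * x ≤ g ρ - ξ * ρ := by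
    intro ξ
    obtain ⟨x, hx, h⟩ := isCompact_Icc.exists_isMinOn (nonempty_Icc.2 hab)
      (f := fun x => g x - ξ * x) (by fun_prop)
    exact ⟨x, hx, fun ρ hρ => h hρ⟩
  choose v hv hmin using this
  refine ⟨v, hv, hmin, ?_, ?_⟩
  · intro ξ hξ
    have h1 := hmin ξ a ⟨le_rfl, hab⟩
    have h2 := hL (v ξ) a
    rw [abs_of_nonneg (by linarith [(hv ξ).1] : 0 ≤ v ξ - a)] at h2
    have h3 := (abs_le.1 h2).1
    have h4 := (hv ξ).1
    by_contra hne
    have : 0 < v ξ - a := by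
      rcases h4.eq_or_lt with h | h
      · exact absurd h.symm hne
      · linarith
    nlinarith
  · intro ξ hξ
    have h1 := hmin ξ b ⟨hab, le_rfl⟩
    have h2 := hL b (v ξ)
    rw [abs_of_nonneg (by linarith [(hv ξ).2] : 0 ≤ b - v ξ)] at h2
    have h3 := (abs_le.1 h2).2
    have h4 := (hv ξ).2
    by_contra hne
    have : 0 < b - v ξ := by
      rcases h4.eq_or_lt with h | h
      · exact absurd h hne
      · linarith
    nlinarith

theorem exists_fan (g : ℝ → ℝ) (hg : Continuous g) (L a b : ℝ)
    (hL : ∀ x y, |g x - g y| ≤ L * |x - y|) : ∃ v, IsFan g L a b v := by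
  rcases le_total a b with hab | hab
  · obtain ⟨v, h1, h2, h3, h4⟩ := exists_argmin g hg L a b hL hab
    have hm := argmin_mono g a b v h1 h2
    refine ⟨v, hm.measurable, hm.countable_not_continuousAt, fan_of_argmin g a b v h1 h2, ?_, h3, h4,
      fun _ => h2, ?_⟩
    · rwa [uIcc_of_le hab]
    · intro hba
      obtain rfl := le_antisymm hab hba
      intro ξ ρ hρ
      have e1 : ρ = a := le_antisymm hρ.2 hρ.1
      have e2 : v ξ = a := le_antisymm (h1 ξ).2 (h1 ξ).1
      rw [e1, e2]
  · obtain ⟨u, h1, h2, h3, h4⟩ := exists_argmin (fun x => - g (-x)) (by fun_prop) L (-a) (-b)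
      (by
        intro x y
        have := hL (-x) (-y)
        rw [show - g (-x) - - g (-y) = -(g (-x) - g (-y)) by ring, abs_neg]
        rwa [show -x - -y = -(x - y) by ring, abs_neg] at this) (by linarith)
    have hm := argmin_mono (fun x => - g (-x)) _ _ u h1 h2
    have h2' : ∀ ξ, ∀ ρ ∈ Icc b a, g ρ - ξ * ρ ≤ g (- u ξ) - ξ * (- u ξ) := by
      intro ξ ρ hρ
      have := h2 ξ (-ρ) ⟨by linarith [hρ.2], by linarith [hρ.1]⟩
      simp only [neg_neg] at this
      linarith
    have hmem : ∀ ξ, - u ξ ∈ Icc b a := fun ξ => ⟨by linarith [(h1 ξ).2], by linarith [(h1 ξ).1]⟩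
    refine ⟨fun ξ => - u ξ, hm.measurable.neg, ?_, ?_, ?_, ?_, ?_, ?_, ?_⟩
    · refine hm.countable_not_continuousAt.mono ?_
      intro ξ hξ hc
      exact hξ hc.neg
    · apply FanIneq.neg
      have := fan_of_argmin (fun x => - g (-x)) _ _ u h1 h2
      simpa only [neg_neg] using this
    · rwa [uIcc_of_ge hab]
    · intro ξ hξ; rw [h3 ξ hξ, neg_neg]
    · intro ξ hξ; rw [h4 ξ hξ, neg_neg]
    · intro hba
      obtain rfl := le_antisymm hab hba
      intro ξ ρ hρ
      have e1 : ρ = b := le_antisymm hρ.2 hρ.1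
      have e2 : - u ξ = b := le_antisymm (hmem ξ).2 (hmem ξ).1
      rw [e1, e2]
    · intro _; exact h2'

/-- Behaviour at `ξ = 0`. -/
theorem IsFan.tendsto_zero {g : ℝ → ℝ} (hg : Continuous g) {L a b c : ℝ} {v : ℝ → ℝ}
    (h : IsFan g L a b v) (hc : c ∈ uIcc a b)
    (h1 : a ≤ b → ∀ ρ ∈ Icc a b, ρ ≠ c → g c < g ρ)
    (h2 : b ≤ a → ∀ ρ ∈ Icc b a, ρ ≠ c → g ρ < g c) :
    v 0 = c ∧ Tendsto v (nhds 0) (nhds c) := by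
  have key : ∀ ξ, |g (v ξ) - g c| ≤ |ξ| * |b - a| := by
    intro ξ
    have hm := h.mem ξ
    have hd : |v ξ - c| ≤ |b - a| := abs_sub_le_of_uIcc_subset_uIcc (uIcc_subset_uIcc hc hm)
    have hh : |ξ * (v ξ - c)| ≤ |ξ| * |b - a| := by
      rw [abs_mul]; exact mul_le_mul_of_nonneg_left hd (abs_nonneg _)
    have h3 := abs_le.1 hh
    rcases le_total a b with hab | hab
    · rw [uIcc_of_le hab] at hc hm
      have := h.var1 hab ξ c hc
      have h4 : g c ≤ g (v ξ) := by
        by_cases e : v ξ = c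
        · rw [e]
        · exact (h1 hab _ hm e).le
      rw [abs_of_nonneg (by linarith)]; linarith
    · rw [uIcc_of_ge hab] at hc hm
      have := h.var2 hab ξ c hc
      have h4 : g (v ξ) ≤ g c := by
        by_cases e : v ξ = c
        · rw [e]
        · exact (h2 hab _ hm e).le
      rw [abs_of_nonpos (by linarith)]; linarith
  have hinj : ∀ ρ ∈ uIcc a b, g ρ = g c → ρ = c := by
    intro ρ hρ e
    by_contra hne
    rcases le_total a b with hab | hab
    · rw [uIcc_of_le hab] at hρ
      exact absurd e (h1 hab ρ hρ hne).ne'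
    · rw [uIcc_of_ge hab] at hρ
      exact absurd e (h2 hab ρ hρ hne).ne
  constructor
  · apply hinj _ (h.mem 0)
    have := key 0
    simp only [abs_zero, zero_mul] at this
    have := abs_eq_zero.1 (le_antisymm this (abs_nonneg _))
    linarith
  · rw [Metric.tendsto_nhds]
    intro δ hδ
    set K := uIcc a b ∩ {ρ | δ ≤ dist ρ c} with hK
    have hKc : IsCompact K := isCompact_uIcc.inter_right
      (isClosed_le continuous_const (continuous_id.dist continuous_const))
    rcases K.eq_empty_or_nonempty with hE | hE
    · refine Eventually.of_forall fun ξ => ?_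
      by_contra hcon
      have : v ξ ∈ K := ⟨h.mem ξ, not_lt.1 hcon⟩
      rw [hE] at this; exact this
    · obtain ⟨ρ1, hρ1, hmin⟩ := hKc.exists_isMinOn hE (f := fun ρ => |g ρ - g c|) (by fun_prop)
      have hpos : 0 < |g ρ1 - g c| := by
        rw [abs_pos, sub_ne_zero]
        intro e
        have := hinj ρ1 hρ1.1 e
        have h' := hρ1.2
        rw [this] at h'
        simp only [mem_ofPred_eq, dist_self] at h'
        linarith
      have ht : Tendsto (fun ξ : ℝ => |ξ| * |b - a|) (nhds 0) (nhds 0) := by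
        have : Continuous fun ξ : ℝ => |ξ| * |b - a| := by fun_prop
        simpa using this.tendsto 0
      filter_upwards [ht.eventually_lt_const hpos] with ξ hξ
      by_contra hcon
      have hm : v ξ ∈ K := ⟨h.mem ξ, not_lt.1 hcon⟩
      have h5 : |g ρ1 - g c| ≤ |g (v ξ) - g c| := hmin hm
      linarith [key ξ]

end

section

theorem testfn_bounds {φ : ℝ × ℝ → ℝ} (h : TestFn φ) :
    ∃ M > (0:ℝ), ∃ C > (0:ℝ), (∀ z, |φ z| ≤ C ∧ |pdT φ z| ≤ C ∧ |pdX φ z| ≤ C) ∧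
      (∀ z : ℝ × ℝ, M ≤ |z.1| ∨ M ≤ |z.2| → φ z = 0 ∧ pdT φ z = 0 ∧ pdX φ z = 0) ∧
      Continuous φ ∧ Continuous (pdT φ) ∧ Continuous (pdX φ) := by
  obtain ⟨hs, hc⟩ := h
  have c0 : Continuous φ := hs.continuous
  have c1 : Continuous (fderiv ℝ φ) := hs.continuous_fderiv (by simp)
  have c2 : Continuous (pdT φ) := c1.clm_apply continuous_const
  have c3 : Continuous (pdX φ) := c1.clm_apply continuous_const
  obtain ⟨M, hM⟩ := hc.isCompact.isBounded.subset_ball (0 : ℝ × ℝ)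
  have z0 : ∀ z : ℝ × ℝ, M ≤ ‖z‖ → φ z = 0 ∧ fderiv ℝ φ z = 0 := by
    intro z hz
    have hz' : z ∉ tsupport φ := by
      intro hz'
      have := hM hz'
      simp only [Metric.mem_ball, dist_zero_right] at this
      linarith
    exact ⟨image_eq_zero_of_notMem_tsupport hz', by
      by_contra hne
      exact hz' (support_fderiv_subset ℝ hne)⟩
  have z1 : ∀ z : ℝ × ℝ, |M| + 1 ≤ |z.1| ∨ |M| + 1 ≤ |z.2| →
      φ z = 0 ∧ pdT φ z = 0 ∧ pdX φ z = 0 := by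
    intro z hz
    have : M ≤ ‖z‖ := by
      have h1 : |z.1| ≤ ‖z‖ := norm_fst_le z
      have h2 : |z.2| ≤ ‖z‖ := norm_snd_le z
      have h3 := le_abs_self M
      rcases hz with hz | hz <;> linarith
    obtain ⟨h1, h2⟩ := z0 z this
    exact ⟨h1, by simp [pdT, h2], by simp [pdX, h2]⟩
  have bd : ∀ u : ℝ × ℝ → ℝ, Continuous u → (∀ z : ℝ × ℝ, |M| + 1 ≤ |z.1| ∨ |M| + 1 ≤ |z.2| → u z = 0) →
      ∃ C, ∀ z, |u z| ≤ C := by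
    intro u hu hz
    have hcs : HasCompactSupport u := by
      refine HasCompactSupport.intro (isCompact_closedBall (0 : ℝ × ℝ) (|M| + 1)) ?_
      intro z hzz
      apply hz
      simp only [Metric.mem_closedBall, dist_zero_right, not_le, Prod.norm_def, lt_max_iff, Real.norm_eq_abs] at hzz
      exact hzz.imp le_of_lt le_of_lt
    obtain ⟨C, hC⟩ := hcs.exists_bound_of_continuous hu
    exact ⟨C, hC⟩
  obtain ⟨C0, h0⟩ := bd φ c0 fun z hz => (z1 z hz).1
  obtain ⟨C1, h1⟩ := bd _ c2 fun z hz => (z1 z hz).2.1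
  obtain ⟨C2, h2⟩ := bd _ c3 fun z hz => (z1 z hz).2.2
  refine ⟨|M| + 1, by positivity, |C0| + |C1| + |C2| + 1, by positivity, ?_, z1, c0, c2, c3⟩
  intro z
  have := h0 z; have := h1 z; have := h2 z
  have := le_abs_self C0; have := le_abs_self C1; have := le_abs_self C2
  have := abs_nonneg C0; have := abs_nonneg C1; have := abs_nonneg C2
  refine ⟨?_, ?_, ?_⟩ <;> linarith

theorem integrable_bdd_mul {η d : ℝ → ℝ} (hη : Measurable η) {C : ℝ} (hC : ∀ ξ, |η ξ| ≤ C)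
    (hd : Continuous d) {M : ℝ} (hM : ∀ ξ, M ≤ |ξ| → d ξ = 0) :
    Integrable (fun ξ => η ξ * d ξ) := by
  have : Integrable d := by
    refine hd.integrable_of_hasCompactSupport (HasCompactSupport.intro (isCompact_Icc (a := -M) (b := M)) ?_)
    intro x hx
    apply hM
    by_contra hcon
    push Not at hcon
    exact hx (abs_le.1 hcon.le)
  exact this.bdd_mul hη.aestronglyMeasurable (Eventually.of_forall hC)

theorem hasDeriv_x {φ : ℝ × ℝ → ℝ} (h : TestFn φ) (t ξ : ℝ) :
    HasDerivAt (fun ξ => φ (t, t * ξ)) (t * pdX φ (t, t * ξ)) ξ := by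
  have h1 : HasFDerivAt φ (fderiv ℝ φ (t, t * ξ)) (t, t * ξ) :=
    (h.1.differentiable (by simp) _).hasFDerivAt
  have h2 : HasDerivAt (fun ξ : ℝ => (t, t * ξ)) ((0, t) : ℝ × ℝ) ξ :=
    (hasDerivAt_const ξ t).prodMk (by simpa using (hasDerivAt_id ξ).const_mul t)
  refine (h1.comp_hasDerivAt ξ h2).congr_deriv ?_
  rw [show ((0, t) : ℝ × ℝ) = t • ((0, 1) : ℝ × ℝ) by simp, map_smul]
  rfl

theorem hasDeriv_t {φ : ℝ × ℝ → ℝ} (h : TestFn φ) (t ξ : ℝ) :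
    HasDerivAt (fun t => t * φ (t, t * ξ))
      (φ (t, t * ξ) + t * (pdT φ (t, t * ξ) + ξ * pdX φ (t, t * ξ))) t := by
  have h1 : HasFDerivAt φ (fderiv ℝ φ (t, t * ξ)) (t, t * ξ) :=
    (h.1.differentiable (by simp) _).hasFDerivAt
  have h2 : HasDerivAt (fun t : ℝ => (t, t * ξ)) ((1, ξ) : ℝ × ℝ) t :=
    (hasDerivAt_id t).prodMk (by simpa using (hasDerivAt_id t).mul_const ξ)
  have h3 := h1.comp_hasDerivAt t h2
  refine ((hasDerivAt_id t).mul h3).congr_deriv ?_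
  rw [show ((1, ξ) : ℝ × ℝ) = (1, 0) + ξ • ((0, 1) : ℝ × ℝ) by simp, map_add, map_smul]
  simp [pdT, pdX]

/-- One-dimensional entropy inequality for a profile. -/
def LineIneq (η Φ : ℝ → ℝ) (B : ℝ) : Prop :=
  ∀ χ χ' : ℝ → ℝ, ∀ M > (0:ℝ), (∀ x, HasDerivAt χ (χ' x) x) → Continuous χ' → (∀ x, 0 ≤ χ x) →
    (∀ x, M ≤ |x| → χ x = 0 ∧ χ' x = 0) →
    B * χ 0 ≤ ∫ ξ, ((Φ ξ - ξ * η ξ) * χ' ξ - η ξ * χ ξ)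

theorem ent_core {η Φ : ℝ → ℝ} (hη : Measurable η) (hΦ : Measurable Φ) {C : ℝ}
    (hηC : ∀ ξ, |η ξ| ≤ C) (hΦC : ∀ ξ, |Φ ξ| ≤ C) {B A ηL ηR : ℝ} (hline : LineIneq η Φ B)
    (hA1 : ∀ ξ, ξ < -A → η ξ = ηL) (hA2 : ∀ ξ, A < ξ → η ξ = ηR)
    {φ : ℝ × ℝ → ℝ} (hφ : TestFn φ) (hpos : ∀ z, 0 ≤ φ z) :
    0 ≤ (∫ t in Ioi (0:ℝ), ∫ x, (η (x / t) * pdT φ (t, x) + Φ (x / t) * pdX φ (t, x)))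
      - B * (∫ t in Ioi (0:ℝ), φ (t, 0)) + ∫ x, (if x < 0 then ηL else ηR) * φ (0, x) := by
  obtain ⟨M, hM, C', hC', hb, hz, c0, c1, c2⟩ := testfn_bounds hφ
  have hC0 : 0 ≤ C := (abs_nonneg _).trans (hηC 0)
  set F : ℝ → ℝ := fun t => ∫ x, (η (x / t) * pdT φ (t, x) + Φ (x / t) * pdX φ (t, x)) with hF
  have hFzero : ∀ t, M ≤ |t| → F t = 0 := by
    intro t ht
    simp only [hF]
    have : ∀ x, η (x / t) * pdT φ (t, x) + Φ (x / t) * pdX φ (t, x) = 0 := by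
      intro x
      obtain ⟨-, h1, h2⟩ := hz (t, x) (Or.inl ht)
      rw [h1, h2]; ring
    simp [this]
  have hFbd : ∀ t, ‖F t‖ ≤ (2 * C * C') * |M - -M| := by
    intro t
    have : F t = ∫ x in (-M)..M, (η (x / t) * pdT φ (t, x) + Φ (x / t) * pdX φ (t, x)) := by
      symm
      apply intervalIntegral.integral_eq_integral_of_support_subset
      intro x hx
      by_contra hcon
      apply hx
      have : M ≤ |x| := by
        by_contra h; push Not at h
        exact hcon ⟨(abs_lt.1 h).1, (abs_lt.1 h).2.le⟩
      obtain ⟨-, h1, h2⟩ := hz (t, x) (Or.inr this)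
      simp [h1, h2]
    rw [this]
    apply intervalIntegral.norm_integral_le_of_norm_le_const
    intro x _
    obtain ⟨-, h1, h2⟩ := hb (t, x)
    have a1 := abs_add_le (η (x / t) * pdT φ (t, x)) (Φ (x / t) * pdX φ (t, x))
    rw [abs_mul, abs_mul] at a1
    have a2 := mul_le_mul (hηC (x / t)) h1 (abs_nonneg _) hC0
    have a3 := mul_le_mul (hΦC (x / t)) h2 (abs_nonneg _) hC0
    rw [Real.norm_eq_abs]; linarith
  have hFm : StronglyMeasurable F := by
    have : Measurable (Function.uncurry fun t x : ℝ =>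
        (η (x / t) * pdT φ (t, x) + Φ (x / t) * pdX φ (t, x))) := by
      have hq : Measurable fun p : ℝ × ℝ => p.2 / p.1 := measurable_snd.div measurable_fst
      exact ((hη.comp hq).mul c1.measurable).add ((hΦ.comp hq).mul c2.measurable)
    exact this.stronglyMeasurable.integral_prod_right
  have hFi : ∀ a b : ℝ, IntervalIntegrable F volume a b := by
    intro a b
    rw [intervalIntegrable_iff]
    exact Measure.integrableOn_of_bounded (by simp) hFm.aestronglyMeasurable
      (Eventually.of_forall hFbd)
  have redF : ∀ G : ℝ → ℝ, (∀ t, M ≤ |t| → G t = 0) → ∫ t in Ioi (0:ℝ), G t = ∫ t in (0:ℝ)..M, G t := by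
    intro G hG
    rw [intervalIntegral.integral_of_le hM.le]
    apply setIntegral_eq_of_subset_of_forall_sdiff_eq_zero measurableSet_Ioi Ioc_subset_Ioi_self
    intro t ht
    apply hG
    have h1 : 0 < t := ht.1
    have h2 : M < t := by
      by_contra h; push Not at h; exact ht.2 ⟨h1, h⟩
    rw [abs_of_pos h1]; exact h2.le
  have hφc : Continuous fun t : ℝ => φ (t, 0) := by fun_prop
  -- the claim on `[ε, M]`
  have claim : ∀ ε, 0 < ε → ε < M →
      B * (∫ t in ε..M, φ (t, 0)) - (∫ x, η (x / ε) * φ (ε, x)) ≤ ∫ t in ε..M, F t := by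
    intro ε hε hεM
    set D : ℝ → ℝ → ℝ := fun t ξ =>
      φ (t, t * ξ) + t * (pdT φ (t, t * ξ) + ξ * pdX φ (t, t * ξ)) with hD
    have hDc : Continuous (Function.uncurry D) := by
      simp only [hD, Function.uncurry_def]; fun_prop
    have hbig : ∀ t ξ : ℝ, ε ≤ t → M / ε ≤ |ξ| → φ (t, t * ξ) = 0 ∧ pdT φ (t, t * ξ) = 0 ∧ pdX φ (t, t * ξ) = 0 := by
      intro t ξ ht hξ
      apply hz; right
      show M ≤ |t * ξ|
      rw [abs_mul, abs_of_pos (hε.trans_le ht)]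
      rw [div_le_iff₀ hε] at hξ
      have := abs_nonneg ξ
      nlinarith
    have hDz : ∀ t ξ : ℝ, ε ≤ t → M / ε ≤ |ξ| → D t ξ = 0 := by
      intro t ξ ht hξ
      obtain ⟨h1, h2, h3⟩ := hbig t ξ ht hξ
      simp only [hD, h1, h2, h3]; ring
    have hMε : 0 < M / ε := by positivity
    have hpt : ∀ t ∈ Icc ε M, B * φ (t, 0) + (∫ ξ, η ξ * D t ξ) ≤ F t := by
      intro t ht
      have htpos : 0 < t := hε.trans_le ht.1
      have h1 := hline (fun ξ => φ (t, t * ξ)) (fun ξ => t * pdX φ (t, t * ξ)) (M / ε) hMε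
        (hasDeriv_x hφ t) (by fun_prop) (fun ξ => hpos _)
        (fun ξ hξ => by
          obtain ⟨h1, h2, h3⟩ := hbig t ξ ht.1 hξ
          exact ⟨h1, by rw [h3, mul_zero]⟩)
      simp only [mul_zero] at h1
      have hFt : F t = ∫ ξ, t * (η ξ * pdT φ (t, t * ξ) + Φ ξ * pdX φ (t, t * ξ)) := by
        have := Measure.integral_comp_div (fun ξ => η ξ * pdT φ (t, t * ξ) + Φ ξ * pdX φ (t, t * ξ)) t
        rw [integral_const_mul, abs_of_pos htpos, smul_eq_mul] at *
        rw [← this]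
        simp only [hF]
        congr 1
        ext x
        rw [mul_div_cancel₀ _ htpos.ne']
      have i1 : Integrable fun ξ => (Φ ξ - ξ * η ξ) * (t * pdX φ (t, t * ξ)) - η ξ * φ (t, t * ξ) := by
        have j1 := integrable_bdd_mul hΦ hΦC (d := fun ξ => t * pdX φ (t, t * ξ)) (by fun_prop) (M := M / ε)
          (fun ξ hξ => by rw [(hbig t ξ ht.1 hξ).2.2, mul_zero])
        have j2 := integrable_bdd_mul hη hηC (d := fun ξ => ξ * (t * pdX φ (t, t * ξ)) + φ (t, t * ξ))
          (by fun_prop) (M := M / ε)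
          (fun ξ hξ => by rw [(hbig t ξ ht.1 hξ).2.2, (hbig t ξ ht.1 hξ).1]; ring)
        refine (j1.sub j2).congr (Eventually.of_forall fun ξ => ?_)
        simp only [Pi.sub_apply]; ring
      have i2 : Integrable fun ξ => η ξ * D t ξ :=
        integrable_bdd_mul hη hηC (d := D t) (by simp only [hD]; fun_prop) (M := M / ε)
          (fun ξ hξ => hDz t ξ ht.1 hξ)
      rw [hFt]
      have : ∫ ξ, t * (η ξ * pdT φ (t, t * ξ) + Φ ξ * pdX φ (t, t * ξ)) =
          (∫ ξ, ((Φ ξ - ξ * η ξ) * (t * pdX φ (t, t * ξ)) - η ξ * φ (t, t * ξ))) + ∫ ξ, η ξ * D t ξ := by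
        rw [← integral_add i1 i2]
        congr 1
        ext ξ
        simp only [hD]; ring
      rw [this]
      linarith
    have hprod : Integrable (Function.uncurry fun t ξ => η ξ * D t ξ)
        ((volume.restrict (uIoc ε M)).prod volume) := by
      have e : (volume.restrict (uIoc ε M)).prod (volume : Measure ℝ) =
          ((volume : Measure ℝ).prod volume).restrict (uIoc ε M ×ˢ univ) := by
        rw [← Measure.prod_restrict, Measure.restrict_univ]
      rw [e]
      have hs : IntegrableOn (Function.uncurry fun t ξ => η ξ * D t ξ)
          (Icc ε M ×ˢ Icc (-(M / ε)) (M / ε)) ((volume : Measure ℝ).prod volume) := by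
        have h1 : IntegrableOn (Function.uncurry D) (Icc ε M ×ˢ Icc (-(M / ε)) (M / ε))
            ((volume : Measure ℝ).prod volume) :=
          hDc.continuousOn.integrableOn_compact (isCompact_Icc.prod isCompact_Icc)
        exact Integrable.bdd_mul (f := fun p : ℝ × ℝ => η p.2) h1
          (hη.comp measurable_snd).aestronglyMeasurable (Eventually.of_forall fun p => hηC p.2)
      rw [uIoc_of_le hεM.le]
      have : IntegrableOn (Function.uncurry fun t ξ => η ξ * D t ξ)
          (Icc ε M ×ˢ univ) ((volume : Measure ℝ).prod volume) := by
        refine hs.of_forall_sdiff_eq_zero (measurableSet_Icc.prod MeasurableSet.univ) ?_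
        rintro ⟨t, ξ⟩ ⟨h1, h2⟩
        have h3 : t ∈ Icc ε M := h1.1
        simp only [Function.uncurry]
        rw [hDz t ξ h3.1, mul_zero]
        by_contra hcon
        push Not at hcon
        exact h2 ⟨h3, abs_le.1 hcon.le⟩
      exact this.mono_set (prod_mono Ioc_subset_Icc_self le_rfl)
    have hswap := intervalIntegral_integral_swap hprod
    have hinner : ∀ ξ, ∫ t in ε..M, η ξ * D t ξ = - (η ξ * (ε * φ (ε, ε * ξ))) := by
      intro ξ
      rw [intervalIntegral.integral_const_mul]
      rw [intervalIntegral.integral_eq_sub_of_hasDerivAt (fun t _ => hasDeriv_t hφ t ξ)]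
      · rw [(hz (M, M * ξ) (Or.inl (le_abs_self M))).1]; ring
      · apply Continuous.intervalIntegrable
        fun_prop
    have hend : (∫ x, η (x / ε) * φ (ε, x)) = ∫ ξ, η ξ * (ε * φ (ε, ε * ξ)) := by
      have := Measure.integral_comp_div (fun ξ => η ξ * φ (ε, ε * ξ)) ε
      rw [abs_of_pos hε, smul_eq_mul, ← integral_const_mul] at this
      have e1 : ∀ x, η (x / ε) * φ (ε, ε * (x / ε)) = η (x / ε) * φ (ε, x) := by
        intro x; rw [mul_div_cancel₀ _ hε.ne']
      simp only [e1] at this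
      rw [this]
      congr 1; ext ξ; ring
    simp only [hinner, integral_neg, ← hend] at hswap
    have hIi : IntervalIntegrable (fun t => ∫ ξ, η ξ * D t ξ) volume ε M := by
      rw [intervalIntegrable_iff]
      exact hprod.integral_prod_left
    have hBi : IntervalIntegrable (fun t => B * φ (t, 0)) volume ε M :=
      (hφc.const_mul B).intervalIntegrable _ _
    have := intervalIntegral.integral_mono_on hεM.le (hBi.add hIi) (hFi ε M) hpt
    rw [intervalIntegral.integral_add hBi hIi, hswap, intervalIntegral.integral_const_mul] at this
    linarith
  -- limits
  have t1 : Tendsto (fun ε => ∫ t in ε..M, F t) (nhdsWithin 0 (Ioi 0)) (nhds (∫ t in (0:ℝ)..M, F t)) := by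
    have := (intervalIntegral.continuous_primitive hFi M).neg.tendsto 0
    have e : ∀ (G : ℝ → ℝ) (ε : ℝ), ∫ t in ε..M, G t = - ∫ t in M..ε, G t :=
      fun G ε => intervalIntegral.integral_symm _ _
    simp only [e]
    exact this.mono_left nhdsWithin_le_nhds
  have t2 : Tendsto (fun ε => ∫ t in ε..M, φ (t, 0)) (nhdsWithin 0 (Ioi 0)) (nhds (∫ t in (0:ℝ)..M, φ (t, 0))) := by
    have := (intervalIntegral.continuous_primitive (μ := volume) (fun a b => hφc.intervalIntegrable a b) M).neg.tendsto 0
    have e : ∀ (G : ℝ → ℝ) (ε : ℝ), ∫ t in ε..M, G t = - ∫ t in M..ε, G t :=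
      fun G ε => intervalIntegral.integral_symm _ _
    simp only [e]
    exact this.mono_left nhdsWithin_le_nhds
  have t3 : Tendsto (fun ε => ∫ x, η (x / ε) * φ (ε, x)) (nhdsWithin 0 (Ioi 0))
      (nhds (∫ x, (if x < 0 then ηL else ηR) * φ (0, x))) := by
    apply tendsto_integral_filter_of_dominated_convergence
      (fun x => (Icc (-M) M).indicator (fun _ => C * C') x)
    · refine Eventually.of_forall fun ε => ?_
      have : Continuous fun x : ℝ => φ (ε, x) := by fun_prop
      exact ((hη.comp (measurable_id.div_const ε)).mul this.measurable).aestronglyMeasurable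
    · refine Eventually.of_forall fun ε => Eventually.of_forall fun x => ?_
      by_cases hx : x ∈ Icc (-M) M
      · rw [indicator_of_mem hx, norm_mul]
        exact mul_le_mul (hηC _) (hb _).1 (norm_nonneg _) hC0
      · rw [indicator_of_notMem hx, (hz (ε, x) (Or.inr _)).1, mul_zero, norm_zero]
        by_contra hcon
        push Not at hcon
        exact hx (abs_le.1 hcon.le)
    · rw [integrable_indicator_iff measurableSet_Icc]
      exact integrableOn_const (by simp)
    · have : ∀ᵐ x : ℝ, x ≠ 0 := by simp [ae_iff]
      filter_upwards [this] with x hx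
      have hc : Tendsto (fun ε : ℝ => φ (ε, x)) (nhdsWithin 0 (Ioi 0)) (nhds (φ (0, x))) := by
        have : Continuous fun ε : ℝ => φ (ε, x) := by fun_prop
        exact (this.tendsto 0).mono_left nhdsWithin_le_nhds
      refine Tendsto.mul ?_ hc
      apply tendsto_const_nhds.congr'
      have hd : ∀ᶠ ε : ℝ in nhdsWithin 0 (Ioi 0), |A| * ε < |x| := by
        have : Continuous fun ε : ℝ => |A| * ε := by fun_prop
        have := (this.tendsto 0).mono_left (nhdsWithin_le_nhds (s := Ioi 0))
        simp only [mul_zero] at this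
        exact this.eventually_lt_const (abs_pos.2 hx)
      filter_upwards [hd, self_mem_nhdsWithin] with ε h1 h2
      have h2 : 0 < ε := h2
      have h3 := le_abs_self A
      rcases lt_or_gt_of_ne hx with h | h
      · rw [if_pos h, hA1]
        rw [abs_of_neg h] at h1
        rw [div_lt_iff₀ h2]; nlinarith
      · rw [if_neg (not_lt.2 h.le), hA2]
        rw [abs_of_pos h] at h1
        rw [lt_div_iff₀ h2]; nlinarith
  have hlim := le_of_tendsto_of_tendsto ((t2.const_mul B).sub t3) t1 (by
    filter_upwards [Ioo_mem_nhdsGT hM] with ε hε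
    exact claim ε hε.1 hε.2)
  rw [redF F hFzero, redF (fun t => φ (t, 0)) (fun t ht => (hz (t, 0) (Or.inl ht)).1)]
  linarith

end

section

/-- Glued profile. -/
def prof (vl vr : ℝ → ℝ) (ξ : ℝ) : ℝ := if ξ < 0 then vl ξ else vr ξ

/-- The self-similar solution. -/
def sol (ρL ρR : ℝ) (V : ℝ → ℝ) (t x : ℝ) : ℝ := if 0 < t then V (x / t) else riem ρL ρR x

/-- Regularity properties of a profile. -/
structure IsProf (R A ρL ρR : ℝ) (V : ℝ → ℝ) : Prop where
  meas : Measurable V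
  cnt : {ξ | ¬ ContinuousAt V ξ}.Countable
  mem : ∀ ξ, V ξ ∈ Icc 0 R
  left : ∀ ξ, ξ < -A → V ξ = ρL
  right : ∀ ξ, A < ξ → V ξ = ρR

theorem isProf_prof {g vl vr : ℝ → ℝ} {R L ρL ρR a b : ℝ} (hL0 : 0 ≤ L) (h1 : IsFan g L ρL a vl)
    (h2 : IsFan g L b ρR vr) (hρL : ρL ∈ Icc 0 R) (hρR : ρR ∈ Icc 0 R) (ha : a ∈ Icc 0 R)
    (hb : b ∈ Icc 0 R) : IsProf R L ρL ρR (prof vl vr) := by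
  refine ⟨Measurable.ite measurableSet_Iio h1.meas h2.meas, ?_, ?_, ?_, ?_⟩
  · refine ((h1.cnt.union h2.cnt).union (countable_singleton 0)).mono ?_
    intro ξ hξ
    by_contra hcon
    simp only [mem_union, mem_ofPred_eq, mem_singleton_iff, not_or, not_not] at hcon
    obtain ⟨⟨c1, c2⟩, c3⟩ := hcon
    apply hξ
    rcases lt_or_gt_of_ne c3 with h | h
    · refine c1.congr ?_
      filter_upwards [Iio_mem_nhds h] with y hy
      simp [prof, show y < 0 from hy]
    · refine c2.congr ?_
      filter_upwards [Ioi_mem_nhds h] with y hy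
      have hy : 0 < y := hy
      simp [prof, hy.le]
  · intro ξ
    unfold prof
    split_ifs
    · have := h1.mem ξ
      exact (uIcc_subset_Icc hρL ha) this
    · exact (uIcc_subset_Icc hb hρR) (h2.mem ξ)
  · intro ξ hξ
    have : ξ < 0 := by linarith
    simp only [prof, this, if_true]
    exact h1.left ξ hξ
  · intro ξ hξ
    have : ¬ ξ < 0 := by linarith
    simp only [prof, this, if_false]
    exact h2.right ξ hξ

variable {R A ρL ρR : ℝ} {V : ℝ → ℝ}

theorem sol_meas (h : IsProf R A ρL ρR V) : Measurable (Function.uncurry (sol ρL ρR V)) := by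
  have e : Function.uncurry (sol ρL ρR V) =
      fun p : ℝ × ℝ => if 0 < p.1 then V (p.2 / p.1) else riem ρL ρR p.2 := by
    ext ⟨t, x⟩; rfl
  rw [e]
  refine Measurable.ite (measurableSet_lt measurable_const measurable_fst)
    (h.meas.comp (measurable_snd.div measurable_fst)) ?_
  exact Measurable.ite (measurableSet_lt measurable_snd measurable_const) measurable_const measurable_const

theorem sol_near_zero (h : IsProf R A ρL ρR V) {x : ℝ} (hx : x ≠ 0) :
    ∀ᶠ t : ℝ in nhds 0, sol ρL ρR V t x = riem ρL ρR x := by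
  have hd : ∀ᶠ t : ℝ in nhds 0, |A| * t < |x| := by
    have : Continuous fun t : ℝ => |A| * t := by fun_prop
    have := this.tendsto 0
    simp only [mul_zero] at this
    exact this.eventually_lt_const (abs_pos.2 hx)
  filter_upwards [hd] with t ht
  unfold sol
  split_ifs with h2
  · have h3 := le_abs_self A
    rcases lt_or_gt_of_ne hx with h' | h'
    · rw [riem, if_pos h', h.left]
      rw [abs_of_neg h'] at ht
      rw [div_lt_iff₀ h2]; nlinarith
    · rw [riem, if_neg (not_lt.2 h'.le), h.right]
      rw [abs_of_pos h'] at ht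
      rw [lt_div_iff₀ h2]; nlinarith
  · rfl

theorem sol_mem (h : IsProf R A ρL ρR V) (hρL : ρL ∈ Icc 0 R) (hρR : ρR ∈ Icc 0 R) (t x : ℝ) :
    sol ρL ρR V t x ∈ Icc 0 R := by
  unfold sol riem
  split_ifs
  · exact h.mem _
  · exact hρL
  · exact hρR

theorem sol_reg (h : IsProf R A ρL ρR V) (hρL : ρL ∈ Icc 0 R) (hρR : ρR ∈ Icc 0 R) :
    RegSol R (sol ρL ρR V) := by
  have hmem := sol_mem h hρL hρR
  have hm := sol_meas h
  refine ⟨hm, hmem, ?_⟩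
  intro r hr s hs
  have h0 : (0:ℝ) = ∫ x in Icc (-r) r, (0:ℝ) := by simp
  rw [h0]
  have hms : ∀ t, Measurable (sol ρL ρR V t) := fun t => hm.comp measurable_prodMk_left
  apply tendsto_integral_filter_of_dominated_convergence (fun _ => R)
  · refine Eventually.of_forall fun t => ?_
    have := ((hms t).sub (hms s)).norm
    exact this.aestronglyMeasurable
  · refine Eventually.of_forall fun t => Eventually.of_forall fun x => ?_
    rw [Real.norm_eq_abs, abs_abs]
    have h1 := hmem t x; have h2 := hmem s x
    exact abs_le.2 ⟨by linarith [h1.1, h2.2], by linarith [h1.2, h2.1]⟩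
  · exact integrableOn_const (by simp)
  · have hconv : ∀ᵐ x : ℝ, Tendsto (fun t => sol ρL ρR V t x) (nhdsWithin s (Ici 0))
        (nhds (sol ρL ρR V s x)) := by
      rcases hs.eq_or_lt with rfl | hs
      · have : ∀ᵐ x : ℝ, x ≠ 0 := by simp [ae_iff]
        filter_upwards [this] with x hx
        have h1 := sol_near_zero h hx
        have h2 : sol ρL ρR V 0 x = riem ρL ρR x := by simp [sol]
        rw [h2]
        apply tendsto_const_nhds.congr'
        filter_upwards [nhdsWithin_le_nhds h1] with t ht using ht.symm
      · have hcnt : {x : ℝ | ¬ ContinuousAt V (x / s)}.Countable := by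
          refine h.cnt.preimage (f := fun x : ℝ => x / s) ?_
          intro x y hxy
          exact (div_left_inj' hs.ne').1 hxy
        filter_upwards [hcnt.ae_notMem volume] with x hx
        have hx : ContinuousAt V (x / s) := not_not.1 hx
        have h2 : sol ρL ρR V s x = V (x / s) := by simp [sol, hs]
        rw [h2]
        have h3 : Tendsto (fun t => V (x / t)) (nhds s) (nhds (V (x / s))) :=
          hx.tendsto.comp ((continuousAt_const.div continuousAt_id hs.ne').tendsto)
        refine Tendsto.mono_left ?_ nhdsWithin_le_nhds
        refine h3.congr' ?_
        filter_upwards [Ioi_mem_nhds hs] with t ht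
        simp [sol, show 0 < t from ht]
    filter_upwards [ae_restrict_of_ae hconv] with x hx
    have := (hx.sub_const (sol ρL ρR V s x)).abs
    simpa using this

theorem trace_core {ρ : ℝ → ℝ → ℝ} (hm : Measurable (Function.uncurry ρ)) (hmem : ∀ t x, ρ t x ∈ Icc 0 R)
    {c : ℝ} (hc : c ∈ Icc 0 R) (S : ℝ → Set ℝ)
    (hvol : ∀ ε > 0, volume (S ε) = ENNReal.ofReal ε)
    (hlim : ∀ t > 0, ∀ δ > 0, ∀ᶠ ε in nhdsWithin (0:ℝ) (Ioi 0), ∀ x ∈ S ε, |ρ t x - c| ≤ δ)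
    {φ : ℝ × ℝ → ℝ} (hφ : TestFn φ) :
    Tendsto (fun ε : ℝ => (1 / ε) * ∫ t in Ioi (0:ℝ), ∫ x in S ε,
        |ρ t x - c| * φ (t, x)) (nhdsWithin 0 (Ioi 0)) (nhds 0) := by
  obtain ⟨M, hM, C', hC', hb, hz, c0, c1, c2⟩ := testfn_bounds hφ
  suffices hsuff : Tendsto (fun ε : ℝ => ∫ t in Ioi (0:ℝ), (1 / ε) * ∫ x in S ε,
      |ρ t x - c| * φ (t, x)) (nhdsWithin 0 (Ioi 0)) (nhds (∫ t in Ioi (0:ℝ), (0:ℝ))) by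
    rw [integral_zero] at hsuff
    refine hsuff.congr fun ε => ?_
    exact integral_const_mul _ _
  have hR : 0 ≤ R := hc.1.trans hc.2
  have est : ∀ ε > 0, ∀ t, ∀ K ≥ 0, (∀ x ∈ S ε, |ρ t x - c| ≤ K) →
      ‖1 / ε * ∫ x in S ε, |ρ t x - c| * φ (t, x)‖ ≤ K * C' := by
    intro ε hε t K hK hx
    have := norm_setIntegral_le_of_norm_le_const (μ := volume) (s := S ε)
      (f := fun x => |ρ t x - c| * φ (t, x)) (C := K * C') (by rw [hvol ε hε]; exact ENNReal.ofReal_lt_top)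
      (by
        intro x hxS
        rw [norm_mul, Real.norm_eq_abs, abs_abs]
        exact mul_le_mul (hx x hxS) (hb _).1 (norm_nonneg _) hK)
    rw [Measure.real, hvol ε hε, ENNReal.toReal_ofReal hε.le] at this
    rw [norm_mul, Real.norm_of_nonneg (by positivity : 0 ≤ 1 / ε)]
    calc 1 / ε * _ ≤ 1 / ε * (K * C' * ε) := mul_le_mul_of_nonneg_left this (by positivity)
      _ = K * C' := by field_simp
  have hbd : ∀ t x, |ρ t x - c| ≤ R := by
    intro t x
    have h1 := hmem t x
    exact abs_le.2 ⟨by linarith [h1.1, hc.2], by linarith [h1.2, hc.1]⟩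
  apply tendsto_integral_filter_of_dominated_convergence
      (fun t => (Icc 0 M).indicator (fun _ => R * C') t)
  · refine Eventually.of_forall fun ε => ?_
    have h1 : Measurable (Function.uncurry fun t x => |ρ t x - c| * φ (t, x)) := by
      exact ((hm.sub_const c).norm).mul c0.measurable
    have := h1.stronglyMeasurable.integral_prod_right (ν := volume.restrict (S ε))
    exact (this.const_mul (1 / ε)).aestronglyMeasurable
  · filter_upwards [self_mem_nhdsWithin] with ε hε
    filter_upwards [ae_restrict_mem measurableSet_Ioi] with t ht
    by_cases htM : t ∈ Icc 0 M
    · rw [indicator_of_mem htM]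
      exact est ε hε t R hR fun x _ => hbd t x
    · rw [indicator_of_notMem htM]
      have : M ≤ |t| := by
        have ht : 0 < t := ht
        by_contra hcon
        push Not at hcon
        exact htM ⟨ht.le, (abs_lt.1 hcon).2.le⟩
      have : ∀ x, |ρ t x - c| * φ (t, x) = 0 := fun x => by rw [(hz (t, x) (Or.inl this)).1, mul_zero]
      simp [this]
  · refine Integrable.integrableOn ?_
    rw [integrable_indicator_iff measurableSet_Icc]
    exact integrableOn_const (by simp)
  · filter_upwards [ae_restrict_mem measurableSet_Ioi] with t ht
    rw [Metric.tendsto_nhds]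
    intro δ hδ
    have hδ' : 0 < δ / (2 * C') := by positivity
    filter_upwards [hlim t ht _ hδ', self_mem_nhdsWithin] with ε h1 h2
    rw [dist_zero_right]
    refine (est ε h2 t _ hδ'.le h1).trans_lt ?_
    have : δ / (2 * C') * C' = δ / 2 := by field_simp
    rw [this]; linarith

theorem sol_left (h : IsProf R A ρL ρR V) (hρL : ρL ∈ Icc 0 R) (hρR : ρR ∈ Icc 0 R) {c : ℝ}
    (hc : c ∈ Icc 0 R) (hV : Tendsto V (nhdsWithin 0 (Iio 0)) (nhds c)) :
    LeftTraceAt (sol ρL ρR V) (fun _ => c) := by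
  intro φ hφ
  refine trace_core (sol_meas h) (sol_mem h hρL hρR) hc (fun ε => Ioo (-ε) 0) ?_ ?_ hφ
  · intro ε hε; simp
  · intro t ht δ hδ
    have := (Metric.tendsto_nhds.1 hV δ hδ)
    rw [eventually_nhdsWithin_iff, Metric.eventually_nhds_iff] at this
    obtain ⟨r, hr, h1⟩ := this
    filter_upwards [Ioo_mem_nhdsGT (mul_pos hr ht)] with ε hε x hx
    have hx0 : x / t < 0 := div_neg_of_neg_of_pos hx.2 ht
    have := h1 (y := x / t) (by
      rw [dist_zero_right, Real.norm_eq_abs, abs_of_neg hx0, ← neg_div, div_lt_iff₀ ht]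
      linarith [hx.1, hε.2]) hx0
    rw [Real.dist_eq] at this
    simpa [sol, ht] using this.le

theorem sol_right (h : IsProf R A ρL ρR V) (hρL : ρL ∈ Icc 0 R) (hρR : ρR ∈ Icc 0 R) {c : ℝ}
    (hc : c ∈ Icc 0 R) (hV : Tendsto V (nhdsWithin 0 (Ioi 0)) (nhds c)) :
    RightTraceAt (sol ρL ρR V) (fun _ => c) := by
  intro φ hφ
  refine trace_core (sol_meas h) (sol_mem h hρL hρR) hc (fun ε => Ioo 0 ε) ?_ ?_ hφ
  · intro ε hε; simp
  · intro t ht δ hδ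
    have := (Metric.tendsto_nhds.1 hV δ hδ)
    rw [eventually_nhdsWithin_iff, Metric.eventually_nhds_iff] at this
    obtain ⟨r, hr, h1⟩ := this
    filter_upwards [Ioo_mem_nhdsGT (mul_pos hr ht)] with ε hε x hx
    have hx0 : 0 < x / t := div_pos hx.1 ht
    have := h1 (y := x / t) (by
      rw [dist_zero_right, Real.norm_eq_abs, abs_of_pos hx0, div_lt_iff₀ ht]
      linarith [hx.2, hε.2]) hx0
    rw [Real.dist_eq] at this
    simpa [sol, ht] using this.le

theorem measurable_rsign : Measurable Real.sign := by
  unfold Real.sign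
  exact Measurable.ite measurableSet_Iio measurable_const
    (Measurable.ite measurableSet_Ioi measurable_const measurable_const)

/-- Kruzkov flux. -/
def kf (g : ℝ → ℝ) (k a : ℝ) : ℝ := Real.sign (a - k) * (g a - g k)

theorem kf_meas {g : ℝ → ℝ} (hg : Continuous g) (hV : Measurable V) (k : ℝ) :
    Measurable fun ξ => kf g k (V ξ) :=
  (measurable_rsign.comp (hV.sub_const k)).mul ((hg.measurable.comp hV).sub_const _)

theorem abs_sign_le (x : ℝ) : |Real.sign x| ≤ 1 := by
  rcases lt_trichotomy x 0 with h | h | h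
  · simp [Real.sign_of_neg h]
  · simp [h]
  · simp [Real.sign_of_pos h]

theorem line_prof {g vl vr : ℝ → ℝ} {L a b k : ℝ} (hg : Continuous g)
    (hL : ∀ x y, |g x - g y| ≤ L * |x - y|) (hL0 : 0 ≤ L)
    (h1 : FanIneq g vl) (h2 : FanIneq g vr) (e1 : vl 0 = a) (e2 : vr 0 = b)
    (hP : IsProf R A ρL ρR (prof vl vr)) (hk : k ∈ Icc 0 R) :
    LineIneq (fun ξ => |prof vl vr ξ - k|) (fun ξ => kf g k (prof vl vr ξ)) (kf g k a - kf g k b) := by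
  intro χ χ' M hM hχ hχ' hpos hz
  set V := prof vl vr with hV
  have hχc : Continuous χ := continuous_iff_continuousAt.2 fun x => (hχ x).continuousAt
  have hη : Measurable fun ξ => |V ξ - k| := (hP.meas.sub_const k).norm
  have hΦ : Measurable fun ξ => kf g k (V ξ) := kf_meas hg hP.meas k
  have hηC : ∀ ξ, |(|V ξ - k|)| ≤ R := by
    intro ξ
    have h1 := hP.mem ξ
    rw [abs_abs]
    exact abs_le.2 ⟨by linarith [h1.1, hk.2], by linarith [h1.2, hk.1]⟩
  have hΦC : ∀ ξ, |kf g k (V ξ)| ≤ L * R := by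
    intro ξ
    have h3 := hηC ξ
    rw [abs_abs] at h3
    rw [kf, abs_mul]
    calc _ ≤ 1 * (L * |V ξ - k|) := mul_le_mul (abs_sign_le _) (hL _ _) (abs_nonneg _) zero_le_one
      _ ≤ _ := by rw [one_mul]; exact mul_le_mul_of_nonneg_left h3 hL0
  set G : ℝ → ℝ := fun ξ => (kf g k (V ξ) - ξ * |V ξ - k|) * χ' ξ - |V ξ - k| * χ ξ with hG
  have hGi : Integrable G := by
    have j1 := integrable_bdd_mul hΦ hΦC hχ' (M := M) (fun ξ hξ => (hz ξ hξ).2)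
    have j2 := integrable_bdd_mul hη hηC (d := fun ξ => ξ * χ' ξ + χ ξ)
      (by fun_prop) (M := M) (fun ξ hξ => by rw [(hz ξ hξ).1, (hz ξ hξ).2]; ring)
    refine (j1.sub j2).congr (Eventually.of_forall fun ξ => ?_)
    simp only [Pi.sub_apply, hG]; ring
  have hred : ∫ ξ, G ξ = ∫ ξ in (-M)..M, G ξ := by
    symm
    apply intervalIntegral.integral_eq_integral_of_support_subset
    intro x hx
    by_contra hcon
    apply hx
    have : M ≤ |x| := by
      by_contra h; push Not at h
      exact hcon ⟨(abs_lt.1 h).1, (abs_lt.1 h).2.le⟩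
    simp [hG, (hz x this).1, (hz x this).2]
  show _ ≤ ∫ ξ, G ξ
  rw [hred, ← intervalIntegral.integral_add_adjacent_intervals (b := 0) hGi.intervalIntegrable
    hGi.intervalIntegrable]
  have q1 := h1 k (-M) 0 (by linarith) χ χ' hχ hχ' hpos
  have q2 := h2 k 0 M hM.le χ χ' hχ hχ' hpos
  rw [(hz (-M) (by rw [abs_neg]; exact le_abs_self M)).1] at q1
  rw [(hz M (le_abs_self M)).1] at q2
  have s1 : ∫ ξ in (-M)..0, (hK g vl k ξ * χ' ξ - |vl ξ - k| * χ ξ) = ∫ ξ in (-M)..0, G ξ := by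
    apply intervalIntegral.integral_congr_ae
    have : ∀ᵐ x : ℝ, x ≠ 0 := by simp [ae_iff]
    filter_upwards [this] with x hx hxI
    rw [uIoc_of_le (by linarith)] at hxI
    have : x < 0 := lt_of_le_of_ne hxI.2 hx
    simp [hG, hV, prof, this, hK, kf]
  have s2 : ∫ ξ in 0..M, (hK g vr k ξ * χ' ξ - |vr ξ - k| * χ ξ) = ∫ ξ in 0..M, G ξ := by
    apply intervalIntegral.integral_congr_ae
    refine Eventually.of_forall fun x hxI => ?_
    rw [uIoc_of_le hM.le] at hxI
    have hx0 : ¬ x < 0 := not_lt.2 hxI.1.le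
    simp [hG, hV, prof, hx0, hK, kf]
  rw [s1] at q1
  rw [s2] at q2
  have r1 : hK g vl k 0 = kf g k a := by simp [hK, kf, e1]
  have r2 : hK g vr k 0 = kf g k b := by simp [hK, kf, e2]
  rw [r1] at q1
  rw [r2] at q2
  linarith

end

section

theorem strict_of_deriv {f : ℝ → ℝ} {K : NNReal} {a b : ℝ} (hab : a < b)
    (hf : LipschitzOnWith K f (Icc a b)) (hd : ∀ᵐ x ∂(volume.restrict (Ioc a b)), 0 < deriv f x) :
    f a < f b := by
  have hac : AbsolutelyContinuousOnInterval f a b := by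
    apply LipschitzOnWith.absolutelyContinuousOnInterval (K := K)
    rwa [uIcc_of_le hab.le]
  have h1 := hac.integral_deriv_eq_sub
  have h2 := hac.intervalIntegrable_deriv
  have h3 : 0 < ∫ x in a..b, deriv f x := by
    rw [intervalIntegral.integral_pos_iff_support_of_nonneg_ae' _ h2]
    · refine ⟨hab, ?_⟩
      have : (volume.restrict (Ioc a b)) (Function.support (deriv f)) = (volume.restrict (Ioc a b)) univ := by
        apply measure_congr
        filter_upwards [hd] with x hx
        apply propext
        exact ⟨fun _ => trivial, fun _ => hx.ne'⟩
      rw [Measure.restrict_apply' measurableSet_Ioc] at this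
      rw [this]
      simp [hab]
    · rw [uIoc_of_le hab.le]
      filter_upwards [hd] with x hx using hx.le
  linarith

theorem f_mono {R ρb : ℝ} {f : ℝ → ℝ} (hF : AF R ρb f) :
    StrictMonoOn f (Icc 0 ρb) ∧ StrictAntiOn f (Icc ρb R) := by
  obtain ⟨hR, ⟨L, hL⟩, h0, h00, hRR, hb, hd⟩ := hF
  have hne : ∀ᵐ x : ℝ, x ≠ ρb := by simp [ae_iff]
  constructor
  · intro a ha b hb' hab
    have hsub : Icc a b ⊆ Icc 0 R := Icc_subset_Icc ha.1 (hb'.2.trans hb.2.le)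
    apply strict_of_deriv hab (hL.mono hsub)
    have := ae_restrict_of_ae_restrict_of_subset (Ioc_subset_Icc_self.trans hsub) hd
    filter_upwards [this, ae_restrict_of_ae hne, ae_restrict_mem measurableSet_Ioc] with x hx hn hm
    have : 0 < ρb - x := by
      have := lt_of_le_of_ne (hm.2.trans hb'.2) hn
      linarith
    exact (pos_iff_pos_of_mul_pos hx).2 this
  · intro a ha b hb' hab
    have hsub : Icc a b ⊆ Icc 0 R := Icc_subset_Icc (hb.1.le.trans ha.1) hb'.2
    have : (fun x => - f x) a < (fun x => - f x) b := by
      apply strict_of_deriv (K := L) hab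
      · have := (hL.mono hsub)
        intro x hx y hy
        have := this hx hy
        simpa [edist_neg_neg] using this
      have := ae_restrict_of_ae_restrict_of_subset (Ioc_subset_Icc_self.trans hsub) hd
      filter_upwards [this, ae_restrict_of_ae hne, ae_restrict_mem measurableSet_Ioc] with x hx hn hm
      have h1 : ρb - x < 0 := by
        have := hm.1; have := ha.1
        linarith
      have : deriv (fun x => - f x) x = - deriv f x := deriv.fun_neg
      rw [this]
      by_contra hc
      nlinarith
    simp only at this
    linarith

theorem wavg_mem {w : ℝ → ℝ} (hW : AW w) {u : ℝ → ℝ} (hu : Measurable u) {a b : ℝ}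
    (h : ∀ x < 0, u x ∈ Icc a b) : (∫ x in Iic (0:ℝ), w x * u x) ∈ Icc a b := by
  obtain ⟨w0, wm, w1, -⟩ := hW
  have wi : IntegrableOn w (Iic 0) := by
    by_contra hc
    rw [integral_undef hc] at w1
    norm_num at w1
  have hne : ∀ᵐ x : ℝ, x ≠ 0 := by simp [ae_iff]
  have hm : ∀ᵐ x ∂(volume.restrict (Iic (0:ℝ))), u x ∈ Icc a b ∧ 0 ≤ w x := by
    filter_upwards [ae_restrict_of_ae hne, ae_restrict_mem measurableSet_Iic] with x hx hx'
    exact ⟨h x (lt_of_le_of_ne hx' hx), w0 x hx'⟩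
  have ui : IntegrableOn (fun x => w x * u x) (Iic 0) := by
    apply Integrable.mul_bdd (c := max |a| |b|) wi hu.aestronglyMeasurable
    filter_upwards [hm] with x hx
    exact abs_le_max_abs_abs hx.1.1 hx.1.2
  have e : ∀ c : ℝ, ∫ x in Iic (0:ℝ), w x * c = c := by
    intro c
    rw [integral_mul_const, w1, one_mul]
  constructor
  · rw [← e a]
    apply integral_mono_ae (wi.mul_const a) ui
    filter_upwards [hm] with x hx
    exact mul_le_mul_of_nonneg_left hx.1.1 hx.2
  · rw [← e b]
    apply integral_mono_ae ui (wi.mul_const b)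
    filter_upwards [hm] with x hx
    exact mul_le_mul_of_nonneg_left hx.1.2 hx.2

theorem wavg_tendsto {R A ρL ρR : ℝ} {V w : ℝ → ℝ} (hW : AW w) (hV : IsProf R A ρL ρR V)
    (hL : ρL ∈ Icc 0 R) (hR : ρR ∈ Icc 0 R) :
    Tendsto (wAvg w (sol ρL ρR V)) (nhdsWithin 0 (Ioi 0)) (nhds ρL) := by
  obtain ⟨w0, wm, w1, -⟩ := hW
  have wi : IntegrableOn w (Iic 0) := by
    by_contra hc
    rw [integral_undef hc] at w1
    norm_num at w1
  have hne : ∀ᵐ x : ℝ, x ≠ 0 := by simp [ae_iff]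
  have e : ∫ x in Iic (0:ℝ), w x * ρL = ρL := by
    rw [integral_mul_const, w1, one_mul]
  nth_rewrite 2 [← e]
  unfold wAvg
  have hme : Measurable (Function.uncurry (sol ρL ρR V)) := sol_meas hV
  apply tendsto_integral_filter_of_dominated_convergence (fun x => |w x| * R)
  · refine Eventually.of_forall fun t => ?_
    exact wi.aestronglyMeasurable.mul (hme.comp (measurable_const.prodMk measurable_id)).aestronglyMeasurable
  · refine Eventually.of_forall fun t => Eventually.of_forall fun x => ?_
    have := sol_mem hV hL hR t x
    rw [Real.norm_eq_abs, abs_mul, abs_of_nonneg this.1]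
    exact mul_le_mul_of_nonneg_left this.2 (abs_nonneg _)
  · exact wi.abs.mul_const R
  · filter_upwards [ae_restrict_of_ae hne, ae_restrict_mem measurableSet_Iic] with x hx hx'
    have hx0 : x < 0 := lt_of_le_of_ne hx' hx
    apply tendsto_nhds_of_eventually_eq
    filter_upwards [(sol_near_zero hV hx).filter_mono nhdsWithin_le_nhds] with t ht
    rw [ht, riem, if_pos hx0]

end

section

theorem bdry_ineq {R ρb : ℝ} {f : ℝ → ℝ} (hm : StrictMonoOn f (Icc 0 ρb))
    (ha : StrictAntiOn f (Icc ρb R)) {ρh ρc pbar k : ℝ}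
    (hp : pbar ∈ Ioc 0 (f ρb)) (hh : ρh ∈ Icc ρb R) (hc : ρc ∈ Icc 0 ρb)
    (eh : f ρh = pbar) (ec : f ρc = pbar) (hk : k ∈ Icc 0 R) (hk0 : 0 ≤ f k) :
    0 ≤ (kf f k ρh - kf f k ρc) + 2 * ((1 - pbar / f ρb) * f k) := by
  have hfb : 0 < f ρb := hp.1.trans_le hp.2
  have hq : pbar / f ρb ≤ 1 := (div_le_one hfb).2 hp.2
  have hX : 0 ≤ (1 - pbar / f ρb) * f k := mul_nonneg (by linarith) hk0
  have hcb : ρc ≤ ρh := hc.2.trans hh.1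
  have hfk : f k ≤ f ρb := by
    rcases le_total k ρb with h | h
    · exact hm.monotoneOn ⟨hk.1, h⟩ ⟨hk.1.trans h, le_rfl⟩ h
    · exact ha.antitoneOn ⟨le_rfl, h.trans hk.2⟩ ⟨h, hk.2⟩ h
  unfold kf
  rw [eh, ec]
  rcases lt_trichotomy k ρc with h | h | h
  · rw [Real.sign_of_pos (sub_pos.2 h), Real.sign_of_pos (sub_pos.2 (h.trans_le hcb))]
    linarith
  · have : f k = pbar := by rw [h, ec]
    rw [this] at hX ⊢
    simp only [sub_self, mul_zero, zero_add]
    linarith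
  · rcases lt_trichotomy k ρh with h' | h' | h'
    · rw [Real.sign_of_neg (sub_neg.2 h), Real.sign_of_pos (sub_pos.2 h')]
      have h1 : (1 - pbar / f ρb) * f k = f k - pbar * (f k / f ρb) := by
        field_simp
      have h2 : f k / f ρb ≤ 1 := (div_le_one hfb).2 hfk
      have h3 : pbar * (f k / f ρb) ≤ pbar * 1 := mul_le_mul_of_nonneg_left h2 hp.1.le
      rw [h1]
      linarith
    · have : f k = pbar := by rw [h', eh]
      rw [this] at hX ⊢
      simp only [sub_self, mul_zero, zero_add]
      linarith
    · rw [Real.sign_of_neg (sub_neg.2 h), Real.sign_of_neg (sub_neg.2 h')]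
      linarith

theorem main_lemma {R ρb : ℝ} {f w p : ℝ → ℝ} (hF : AF R ρb f) (hW : AW w)
    {ρL ρR : ℝ} (hL : ρL ∈ Icc (0:ℝ) R) (hR' : ρR ∈ Icc (0:ℝ) R)
    (h1 : ρR ≤ ρb) (h2 : ρb < ρL) {pbar ρh δ : ℝ} (hp : pbar ∈ Ioc 0 (f ρb))
    (hh : ρh ∈ Icc ρb R) (eh : f ρh = pbar) (hδ : 0 < δ)
    (hadm : ∀ ξ ∈ uIcc ρL ρh, |ξ - ρL| < δ → pbar ∈ Icc (pplus R p ξ) (pminus p ξ)) :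
    ∃ T > (0:ℝ), ∃ V : ℝ → ℝ, ∃ ρc : ℝ, f ρc = pbar ∧
      Tendsto V (nhdsWithin 0 (Iio 0)) (nhds ρh) ∧
      EWSolOn R (f ρb) T f w p (riem ρL ρR) (sol ρL ρR V) (fun _ => ρh) (fun _ => ρc) := by
  obtain ⟨hm, ha⟩ := f_mono hF
  obtain ⟨hR, ⟨K, hK⟩, h0, h00, hRR, hb, hd⟩ := hF
  have hfc : ContinuousOn f (Icc 0 R) := hK.continuousOn
  obtain ⟨ρc, hc, ec⟩ : ∃ ρc ∈ Icc 0 ρb, f ρc = pbar := by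
    have := intermediate_value_Icc hb.1.le (hfc.mono (Icc_subset_Icc le_rfl hb.2.le))
    exact this ⟨by rw [h00]; exact hp.1.le, hp.2⟩
  obtain ⟨g, hgK, hfg⟩ := hK.extend_real
  have hg : Continuous g := hgK.continuous
  have hgL : ∀ x y, |g x - g y| ≤ (K:ℝ) * |x - y| := by
    intro x y
    have := hgK.dist_le_mul x y
    simpa [Real.dist_eq] using this
  have hK0 : (0:ℝ) ≤ K := K.2
  have hhR : ρh ∈ Icc 0 R := ⟨hb.1.le.trans hh.1, hh.2⟩
  have hcR : ρc ∈ Icc 0 R := ⟨hc.1, hc.2.trans hb.2.le⟩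
  obtain ⟨vl, hvl⟩ := exists_fan g hg K ρL ρh hgL
  obtain ⟨vr, hvr⟩ := exists_fan g hg K ρc ρR hgL
  have hgm : StrictMonoOn g (Icc 0 ρb) :=
    hm.congr (hfg.mono (Icc_subset_Icc le_rfl hb.2.le))
  have hga : StrictAntiOn g (Icc ρb R) :=
    ha.congr (hfg.mono (Icc_subset_Icc hb.1.le le_rfl))
  obtain ⟨vl0, tl⟩ := hvl.tendsto_zero hg (c := ρh) right_mem_uIcc
    (fun hab ρ hρ hne => hga ⟨h2.le.trans hρ.1, hρ.2.trans hh.2⟩ hh (lt_of_le_of_ne hρ.2 hne))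
    (fun hab ρ hρ hne => hga hh ⟨hh.1.trans hρ.1, hρ.2.trans hL.2⟩
      (lt_of_le_of_ne hρ.1 hne.symm))
  obtain ⟨vr0, tr⟩ := hvr.tendsto_zero hg (c := ρc) left_mem_uIcc
    (fun hab ρ hρ hne => hgm hc ⟨hc.1.trans hρ.1, hρ.2.trans h1⟩ (lt_of_le_of_ne hρ.1 hne.symm))
    (fun hab ρ hρ hne => hgm ⟨hR'.1.trans hρ.1, hρ.2.trans hc.2⟩ hc (lt_of_le_of_ne hρ.2 hne))
  have hV := isProf_prof hK0 hvl hvr hL hR' hhR hcR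
  set V := prof vl vr with hVdef
  have tVl : Tendsto V (nhdsWithin 0 (Iio 0)) (nhds ρh) := by
    refine (tl.mono_left nhdsWithin_le_nhds).congr' ?_
    filter_upwards [self_mem_nhdsWithin] with ξ hξ
    rw [hVdef, prof, if_pos (mem_Iio.1 hξ)]
  have tVr : Tendsto V (nhdsWithin 0 (Ioi 0)) (nhds ρc) := by
    refine (tr.mono_left nhdsWithin_le_nhds).congr' ?_
    filter_upwards [self_mem_nhdsWithin] with ξ hξ
    rw [hVdef, prof, if_neg (not_lt.2 (le_of_lt hξ))]
  have htend := wavg_tendsto hW hV hL hR'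
  have hev : ∀ᶠ t in nhdsWithin (0:ℝ) (Ioi 0), |wAvg w (sol ρL ρR V) t - ρL| < δ := by
    have := htend.eventually (Metric.ball_mem_nhds ρL hδ)
    filter_upwards [this] with t ht
    exact ht
  obtain ⟨T, hT, hTs⟩ := (mem_nhdsGT_iff_exists_Ioo_subset).1 hev
  refine ⟨T, hT, V, ρc, ec, tVl, fun _ => pbar, ⟨sol_reg hV hL hR', fun _ => ⟨hp.1.le, hp.2⟩,
    ?_, sol_left hV hL hR' hhR tVl, sol_right hV hL hR' hcR tVr, ?_⟩, ?_⟩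
  · intro φ hφ hpos _ k hk
    have hline := line_prof hg hgL hK0 hvl.ineq hvr.ineq vl0 vr0 hV hk
    have hVk : ∀ ξ, |V ξ - k| ≤ R := by
      intro ξ
      have h1 := hV.mem ξ
      rw [abs_le]
      constructor <;> linarith [h1.1, h1.2, hk.1, hk.2]
    have core := ent_core (hη := (hV.meas.sub_const k).norm) (hΦ := kf_meas hg hV.meas k)
      (C := max R (K * R)) (fun ξ => by
        rw [abs_norm]; exact (hVk ξ).trans (le_max_left _ _))
      (fun ξ => by
        refine le_trans ?_ (le_max_right _ _)
        unfold kf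
        rw [abs_mul]
        calc _ ≤ 1 * |g (V ξ) - g k| := mul_le_mul_of_nonneg_right (abs_sign_le _) (abs_nonneg _)
          _ ≤ K * |V ξ - k| := by rw [one_mul]; exact hgL _ _
          _ ≤ K * R := mul_le_mul_of_nonneg_left (hVk ξ) hK0)
      hline (A := K) (ηL := |ρL - k|) (ηR := |ρR - k|)
      (fun ξ hξ => by rw [hV.left ξ hξ]; rfl) (fun ξ hξ => by rw [hV.right ξ hξ]; rfl) hφ hpos
    have e1 : (∫ t in Ioi (0:ℝ), ∫ x : ℝ,
          (|sol ρL ρR V t x - k| * pdT φ (t, x) +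
            Real.sign (sol ρL ρR V t x - k) * (f (sol ρL ρR V t x) - f k) * pdX φ (t, x))) =
        ∫ t in Ioi (0:ℝ), ∫ x, (‖V (x / t) - k‖ * pdT φ (t, x) +
          kf g k (V (x / t)) * pdX φ (t, x)) := by
      apply setIntegral_congr_fun measurableSet_Ioi
      intro t ht
      apply integral_congr_ae
      refine Eventually.of_forall fun x => ?_
      have hs : sol ρL ρR V t x = V (x / t) := if_pos ht
      simp only [hs, kf]
      rw [hfg (hV.mem _), hfg hk]
      rfl
    have e2 : ∀ x, |riem ρL ρR x - k| * φ (0, x) =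
        (if x < 0 then |ρL - k| else |ρR - k|) * φ (0, x) := by
      intro x
      unfold riem
      split_ifs <;> rfl
    have hI : 0 ≤ ∫ t in Ioi (0:ℝ), φ (t, 0) := integral_nonneg fun t => hpos _
    have hB := bdry_ineq hm ha hp hh hc eh ec hk (h0 k hk)
    have eB : kf f k ρh - kf f k ρc = kf g k ρh - kf g k ρc := by
      unfold kf
      rw [hfg hhR, hfg hcR, hfg hk]
    rw [eB] at hB
    simp only [e1, e2]
    rw [integral_const_mul]
    have := mul_nonneg hB hI
    nlinarith [core, this]
  · exact Eventually.of_forall fun t => ⟨eh.le, ec.le⟩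
  · filter_upwards [ae_restrict_mem measurableSet_Ioo] with t ht
    refine hadm _ ?_ (hTs ht)
    apply wavg_mem hW ((sol_meas hV).comp (measurable_const.prodMk measurable_id))
    intro x hx
    have hs : sol ρL ρR V t x = V (x / t) := if_pos ht.1
    have h3 : x / t < 0 := div_neg_of_neg_of_pos hx ht.1
    have : V (x / t) = vl (x / t) := by rw [hVdef, prof, if_pos h3]
    have h4 := hvl.mem (x / t)
    rw [← this, ← hs] at h4
    exact h4

theorem EWSolOn.mono {R fm T T' : ℝ} {f w p ρ0 γm γp : ℝ → ℝ} {ρ : ℝ → ℝ → ℝ} (hT : T' ≤ T)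
    (h : EWSolOn R fm T f w p ρ0 ρ γm γp) : EWSolOn R fm T' f w p ρ0 ρ γm γp := by
  obtain ⟨q, ⟨a1, a2, a3, a4, a5, a6⟩, a7⟩ := h
  have hs : Ioo 0 T' ⊆ Ioo 0 T := Ioo_subset_Ioo le_rfl hT
  refine ⟨q, ⟨a1, a2, ?_, a4, a5, ae_restrict_of_ae_restrict_of_subset hs a6⟩,
    ae_restrict_of_ae_restrict_of_subset hs a7⟩
  intro φ h1 h2 h3
  exact a3 φ h1 h2 (h3.trans (prod_mono (Iio_subset_Iio hT) le_rfl))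

theorem not_aeEq {ρL ρR a b : ℝ} {V W : ℝ → ℝ} (hV : Tendsto V (nhdsWithin 0 (Iio 0)) (nhds a))
    (hW : Tendsto W (nhdsWithin 0 (Iio 0)) (nhds b)) (hab : a ≠ b) {τ : ℝ} (hτ : 0 < τ) :
    ¬ aeEqOn τ (sol ρL ρR V) (sol ρL ρR W) := by
  intro h
  have hev : ∀ᶠ ξ in nhdsWithin (0:ℝ) (Iio 0), V ξ ≠ W ξ := by
    have : Tendsto (fun ξ => V ξ - W ξ) (nhdsWithin 0 (Iio 0)) (nhds (a - b)) := hV.sub hW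
    filter_upwards [this.eventually_ne (sub_ne_zero.2 hab)] with ξ hξ h
    exact hξ (sub_eq_zero.2 h)
  obtain ⟨r, hr, hrs⟩ := (mem_nhdsLT_iff_exists_Ioo_subset).1 hev
  have hr0 : r < 0 := hr
  set S : Set (ℝ × ℝ) := Ioo (τ / 2) τ ×ˢ Ioo (r * (τ / 2)) 0 with hS
  have hSo : IsOpen S := isOpen_Ioo.prod isOpen_Ioo
  have hSn : S.Nonempty := by
    apply Set.Nonempty.prod
    · exact nonempty_Ioo.2 (by linarith)
    · exact nonempty_Ioo.2 (mul_neg_of_neg_of_pos hr0 (by linarith))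
  have hpos := hSo.measure_pos (volume : Measure (ℝ × ℝ)) hSn
  have hsub : S ⊆ Ioo 0 τ ×ˢ univ := prod_mono (Ioo_subset_Ioo (by linarith) le_rfl) (subset_univ _)
  have h' := ae_restrict_of_ae_restrict_of_subset hsub h
  have : ∀ᵐ z ∂((volume : Measure (ℝ × ℝ)).restrict S), False := by
    filter_upwards [h', ae_restrict_mem hSo.measurableSet] with z hz hzS
    obtain ⟨⟨z1, z2⟩, z3, z4⟩ := hzS
    have ht : 0 < z.1 := by linarith
    have e1 : sol ρL ρR V z.1 z.2 = V (z.2 / z.1) := if_pos ht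
    have e2 : sol ρL ρR W z.1 z.2 = W (z.2 / z.1) := if_pos ht
    rw [e1, e2] at hz
    refine hrs (a := z.2 / z.1) ⟨?_, div_neg_of_neg_of_pos z4 ht⟩ hz
    rw [lt_div_iff₀ ht]
    nlinarith
  rw [ae_iff] at this
  simp only [not_false_eq_true, ofPred_true, Measure.restrict_apply_univ] at this
  exact hpos.ne' this

end

section

theorem pplus_attained {R fm : ℝ} {p : ℝ → ℝ} (hP : AP2 R fm p) {ξ : ℝ} (h0 : 0 ≤ ξ)
    (h : ξ < R) : ∃ η ∈ Ioc ξ R, pplus R p ξ = p η := by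
  obtain ⟨-, -, hfin⟩ := hP
  have hs : Ioc ξ R ⊆ Icc 0 R := fun x hx => ⟨h0.trans hx.1.le, hx.2⟩
  have hf : (p '' Ioc ξ R).Finite := hfin.subset (image_mono hs)
  have hn : (p '' Ioc ξ R).Nonempty := (nonempty_Ioc.2 h).image _
  have := hn.csSup_mem hf
  obtain ⟨η, hη, e⟩ := this
  refine ⟨η, hη, ?_⟩
  rw [pplus, if_neg (not_le.2 h), e]

theorem pminus_attained {R fm : ℝ} {p : ℝ → ℝ} (hP : AP2 R fm p) {ξ : ℝ} (h0 : 0 < ξ)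
    (h : ξ ≤ R) : ∃ η ∈ Ico 0 ξ, pminus p ξ = p η := by
  obtain ⟨-, -, hfin⟩ := hP
  have hs : Ico 0 ξ ⊆ Icc 0 R := fun x hx => ⟨hx.1, hx.2.le.trans h⟩
  have hf : (p '' Ico 0 ξ).Finite := hfin.subset (image_mono hs)
  have hn : (p '' Ico 0 ξ).Nonempty := (nonempty_Ico.2 h0).image _
  obtain ⟨η, hη, e⟩ := hn.csInf_mem hf
  refine ⟨η, hη, ?_⟩
  rw [pminus, if_neg (not_le.2 h0), e]

/-- `p(ξ+) ≤ p y` for `y ≤ ξ`. -/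
theorem pplus_le {R fm : ℝ} {p : ℝ → ℝ} (hP : AP2 R fm p) {ξ y : ℝ} (hy : 0 ≤ y) (h0 : y ≤ ξ)
    (h : ξ ≤ R) : pplus R p ξ ≤ p y := by
  rcases h.lt_or_eq with h | h
  · obtain ⟨η, hη, e⟩ := pplus_attained hP (hy.trans h0) h
    rw [e]
    exact hP.1 ⟨hy, h0.trans h.le⟩ ⟨(hy.trans h0).trans hη.1.le, hη.2⟩ (h0.trans hη.1.le)
  · rw [pplus, if_pos h.ge]
    exact hP.1 ⟨hy, h0.trans h.le⟩ ⟨(hy.trans h0).trans h.le, le_rfl⟩ (h0.trans h.le)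

/-- `p y ≤ p(ξ−)` for `ξ ≤ y`. -/
theorem le_pminus {R fm : ℝ} {p : ℝ → ℝ} (hP : AP2 R fm p) {ξ y : ℝ} (hξ : 0 ≤ ξ) (h0 : ξ ≤ y)
    (h : y ≤ R) : p y ≤ pminus p ξ := by
  rcases hξ.lt_or_eq with h' | h'
  · obtain ⟨η, hη, e⟩ := pminus_attained hP h' (h0.trans h)
    rw [e]
    exact hP.1 ⟨hη.1, hη.2.le.trans (h0.trans h)⟩ ⟨hξ.trans h0, h⟩ (hη.2.le.trans h0)
  · rw [pminus, if_pos h'.ge]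
    exact hP.1 ⟨le_rfl, hξ.trans (h0.trans h)⟩ ⟨hξ.trans h0, h⟩ (hξ.trans h0)

theorem pplus_anti {R fm : ℝ} {p : ℝ → ℝ} (hP : AP2 R fm p) {ξ y : ℝ} (hy : 0 ≤ y) (h0 : y ≤ ξ)
    (h : ξ ≤ R) (hyR : y < R) : pplus R p ξ ≤ pplus R p y := by
  obtain ⟨η, hη, e⟩ := pplus_attained hP hy hyR
  have hb : BddAbove (p '' Ioc y R) := (hP.2.2.subset
    (image_mono fun x hx => ⟨hy.trans hx.1.le, hx.2⟩)).bddAbove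
  rcases h.lt_or_eq with h | h
  · rw [pplus, pplus, if_neg (not_le.2 h), if_neg (not_le.2 hyR)]
    exact csSup_le_csSup hb ((nonempty_Ioc.2 h).image _) (image_mono (Ioc_subset_Ioc h0 le_rfl))
  · rw [pplus, pplus, if_pos h.ge, if_neg (not_le.2 hyR)]
    exact le_csSup hb ⟨R, ⟨hyR, le_rfl⟩, rfl⟩

theorem pminus_anti {R fm : ℝ} {p : ℝ → ℝ} (hP : AP2 R fm p) {ξ y : ℝ} (hy : 0 ≤ y) (h0 : y ≤ ξ)
    (h : ξ ≤ R) (hξ : 0 < ξ) : pminus p ξ ≤ pminus p y := by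
  have hb : BddBelow (p '' Ico 0 ξ) := (hP.2.2.subset
    (image_mono fun x hx => ⟨hx.1, hx.2.le.trans h⟩)).bddBelow
  rcases hy.lt_or_eq with h' | h'
  · rw [pminus, pminus, if_neg (not_le.2 hξ), if_neg (not_le.2 h')]
    exact csInf_le_csInf hb ((nonempty_Ico.2 h').image _) (image_mono (Ico_subset_Ico le_rfl h0))
  · rw [pminus, pminus, if_neg (not_le.2 hξ), if_pos h'.ge]
    exact csInf_le hb ⟨0, ⟨le_rfl, hξ⟩, rfl⟩

end

/-- in case (NNN4), for each `p̄ ∈ {p(ρL+), f ρL, p(ρL−)}` the constrained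
Riemann problem admits (locally in time) an entropy weak solution with boundary flux `p̄`;
in particular it admits at least two solutions that do not coincide for small times. -/
theorem stmt10 (R ρb : ℝ) (f w p : ℝ → ℝ) (hF : AF R ρb f) (hW : AW w)
    (hP : AP2 R (f ρb) p) (ρL ρR : ℝ) (hL : ρL ∈ Icc (0:ℝ) R) (hR' : ρR ∈ Icc (0:ℝ) R)
    (h1 : ρR ≤ ρb) (h2 : ρb < ρL) (h3 : pminus p ρL ≠ pplus R p ρL)
    (h4 : pplus R p ρL ≤ f ρL) (h5 : f ρL ≤ pminus p ρL) :
    (∀ pbar ∈ ({pplus R p ρL, f ρL, pminus p ρL} : Set ℝ),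
      ∃ T > (0:ℝ), ∃ ρ : ℝ → ℝ → ℝ, ∃ γm γp : ℝ → ℝ,
        EWSolOn R (f ρb) T f w p (riem ρL ρR) ρ γm γp ∧
        ∀ᵐ t ∂(volume.restrict (Ioo (0:ℝ) T)), f (γm t) = pbar ∧ f (γp t) = pbar) ∧
    ∃ T > (0:ℝ), ∃ ρ1 ρ2 : ℝ → ℝ → ℝ, ∃ γm1 γp1 γm2 γp2 : ℝ → ℝ,
      EWSolOn R (f ρb) T f w p (riem ρL ρR) ρ1 γm1 γp1 ∧
      EWSolOn R (f ρb) T f w p (riem ρL ρR) ρ2 γm2 γp2 ∧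
      ∀ τ ∈ Ioc (0:ℝ) T, ¬ aeEqOn τ ρ1 ρ2 := by
  have hb : ρb ∈ Ioo 0 R := hF.2.2.2.2.2.1
  have hRR : f R = 0 := hF.2.2.2.2.1
  obtain ⟨hm, ha⟩ := f_mono hF
  have hfc : ContinuousOn f (Icc 0 R) := by
    obtain ⟨K, hK⟩ := hF.2.1
    exact hK.continuousOn
  have hL0 : 0 < ρL := hb.1.trans h2
  have hLR : ρL < R := by
    rcases hL.2.lt_or_eq with h | h
    · exact h
    · exfalso
      have h6 : pplus R p ρL = p R := by rw [pplus, if_pos h.ge]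
      have h7 := (hP.2.1 R ⟨hb.1.le.trans hb.2.le, le_rfl⟩).1
      rw [h6, h, hRR] at h4
      linarith
  obtain ⟨η, hη, eη⟩ := pplus_attained hP hL.1 hLR
  obtain ⟨ζ, hζ, eζ⟩ := pminus_attained hP hL0 hL.2
  have hpp : pplus R p ρL ∈ Ioc 0 (f ρb) := by
    rw [eη]; exact hP.2.1 η ⟨hL.1.trans hη.1.le, hη.2⟩
  have hpm : pminus p ρL ∈ Ioc 0 (f ρb) := by
    rw [eζ]; exact hP.2.1 ζ ⟨hζ.1, hζ.2.le.trans hL.2⟩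
  have hLb : ρL ∈ Icc ρb R := ⟨h2.le, hL.2⟩
  have hex : ∀ q ∈ Ioc 0 (f ρb), ∃ ρh ∈ Icc ρb R, f ρh = q := by
    intro q hq
    have := intermediate_value_Icc' hb.2.le (hfc.mono (Icc_subset_Icc hb.1.le le_rfl))
    exact this ⟨by rw [hRR]; exact hq.1.le, hq.2⟩
  have key : ∀ pbar ∈ ({pplus R p ρL, f ρL, pminus p ρL} : Set ℝ),
      ∃ ρh, f ρh = pbar ∧ ∃ T > (0:ℝ), ∃ V : ℝ → ℝ, ∃ ρc : ℝ, f ρc = pbar ∧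
      Tendsto V (nhdsWithin 0 (Iio 0)) (nhds ρh) ∧
      EWSolOn R (f ρb) T f w p (riem ρL ρR) (sol ρL ρR V) (fun _ => ρh) (fun _ => ρc) := by
    rintro pbar (rfl | rfl | rfl)
    · obtain ⟨ρh, hh, eh⟩ := hex _ hpp
      have hle : ρL ≤ ρh := by
        by_contra hc
        have := ha hh hLb (not_le.1 hc)
        linarith
      refine ⟨ρh, eh, main_lemma hF hW hL hR' h1 h2 hpp hh eh (sub_pos.2 hη.1) ?_⟩
      intro ξ hξ hd
      rw [uIcc_of_le hle] at hξ
      have hξη : ξ < η := by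
        have := (abs_lt.1 hd).2
        linarith
      refine ⟨pplus_anti hP hL.1 hξ.1 (hξ.2.trans hh.2) hLR, ?_⟩
      rw [eη]
      exact le_pminus hP (hL.1.trans hξ.1) hξη.le hη.2
    · refine ⟨ρL, rfl, main_lemma hF hW hL hR' h1 h2 ⟨hpp.1.trans_le h4, h5.trans hpm.2⟩ hLb rfl
        one_pos ?_⟩
      intro ξ hξ _
      rw [uIcc_self] at hξ
      rw [mem_singleton_iff.1 hξ]
      exact ⟨h4, h5⟩
    · obtain ⟨ρh, hh, eh⟩ := hex _ hpm
      have hle : ρh ≤ ρL := by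
        by_contra hc
        have := ha hLb hh (not_le.1 hc)
        linarith
      refine ⟨ρh, eh, main_lemma hF hW hL hR' h1 h2 hpm hh eh (sub_pos.2 hζ.2) ?_⟩
      intro ξ hξ hd
      rw [uIcc_of_ge hle] at hξ
      have hξζ : ζ < ξ := by
        have := (abs_lt.1 hd).1
        linarith
      refine ⟨?_, pminus_anti hP (hζ.1.trans hξζ.le) hξ.2 hL.2 hL0⟩
      rw [eζ]
      exact pplus_le hP hζ.1 hξζ.le (hξ.2.trans hL.2)
  constructor
  · intro pbar hpbar
    obtain ⟨ρh, eh, T, hT, V, ρc, ec, -, hS⟩ := key pbar hpbar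
    exact ⟨T, hT, _, _, _, hS, Eventually.of_forall fun t => ⟨eh, ec⟩⟩
  · obtain ⟨a, ea, T1, hT1, V1, c1, -, t1, S1⟩ := key (pplus R p ρL) (by simp)
    obtain ⟨b, eb, T2, hT2, V2, c2, -, t2, S2⟩ := key (pminus p ρL) (by simp)
    have hab : a ≠ b := by
      rintro rfl
      exact h3 (eb.symm.trans ea)
    exact ⟨min T1 T2, lt_min hT1 hT2, _, _, _, _, _, _, S1.mono (min_le_left _ _),
      S2.mono (min_le_right _ _), fun τ hτ => not_aeEq t1 t2 hab hτ.1⟩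

end

end CRP
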